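/- Let f be an endomorphism of A₁. If there exist an involution E on A₁ conjugate to α and an involution Ẽ on A₁ conjugate to α such that Ẽ(f(X)) = f(E(X)) and Ẽ(f(Y)) = f(E(Y)) (equivalently, Ẽ ∘ f = f ∘ E), then f is an automorphism of A₁. -/

import Mathlib

noncomputable section

/-- `f : A → A` is a `K`-algebra endomorphism (as a bare function). -/
def IsAlgEndo (K : Type) [CommSemiring K] {A : Type} [Semiring A] [Algebra K A]
    (f : A → A) : Prop :=
  (∀ a b : A, f (a + b) = f a + f b) ∧
  (∀ (c : K) (a : A), f (c • a) = c • f a) ∧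
  (∀ a b : A, f (a * b) = f a * f b) ∧ f 1 = 1

/-- `f : A → A` is a `K`-algebra automorphism: a bijective endomorphism. -/
def IsAlgAuto (K : Type) [CommSemiring K] {A : Type} [Semiring A] [Algebra K A]
    (f : A → A) : Prop :=
  IsAlgEndo K f ∧ Function.Bijective f

/-- `f : A → A` is a `K`-linear anti-endomorphism. -/
def IsAntiEndo (K : Type) [CommSemiring K] {A : Type} [Semiring A] [Algebra K A]
    (f : A → A) : Prop :=
  (∀ a b : A, f (a + b) = f a + f b) ∧
  (∀ (c : K) (a : A), f (c • a) = c • f a) ∧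
  (∀ a b : A, f (a * b) = f b * f a) ∧ f 1 = 1

/-- `f : A → A` is an anti-automorphism: a bijective anti-endomorphism. -/
def IsAntiAuto (K : Type) [CommSemiring K] {A : Type} [Semiring A] [Algebra K A]
    (f : A → A) : Prop :=
  IsAntiEndo K f ∧ Function.Bijective f

/-- An involution on a `K`-algebra: an anti-automorphism of order at most two. -/
def IsInvolutionOn (K : Type) [CommSemiring K] {A : Type} [Semiring A] [Algebra K A]
    (γ : A → A) : Prop :=
  IsAntiAuto K γ ∧ γ ∘ γ = id

/-- The defining relation of the first Weyl algebra: `Y*X = X*Y + 1`. -/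
inductive WeylRel (K : Type) [CommSemiring K] :
    FreeAlgebra K (Fin 2) → FreeAlgebra K (Fin 2) → Prop
  | rel : WeylRel K (FreeAlgebra.ι K 1 * FreeAlgebra.ι K 0)
      (FreeAlgebra.ι K 0 * FreeAlgebra.ι K 1 + 1)

/-- The first Weyl algebra `A₁(K) = K⟨X,Y⟩/(YX - XY - 1)`. -/
abbrev Weyl (K : Type) [CommSemiring K] : Type := RingQuot (WeylRel K)

/-- The generator `X` of the Weyl algebra. -/
def Wx (K : Type) [CommSemiring K] : Weyl K :=
  RingQuot.mkAlgHom K (WeylRel K) (FreeAlgebra.ι K 0)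

/-- The generator `Y` of the Weyl algebra. -/
def Wy (K : Type) [CommSemiring K] : Weyl K :=
  RingQuot.mkAlgHom K (WeylRel K) (FreeAlgebra.ι K 1)

/-- `α` is the exchange involution: the involution with `α X = Y` and `α Y = X`. -/
def IsExchange (K : Type) [CommSemiring K] (α : Weyl K → Weyl K) : Prop :=
  IsInvolutionOn K α ∧ α (Wx K) = Wy K ∧ α (Wy K) = Wx K

/-- `γ` is conjugate to `α` by an automorphism or an anti-automorphism:
`γ = g⁻¹ ∘ α ∘ g`. -/
def ConjToAlpha (K : Type) [CommSemiring K] (α γ : Weyl K → Weyl K) : Prop :=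
  ∃ g : Weyl K → Weyl K, (IsAlgAuto K g ∨ IsAntiAuto K g) ∧
    γ = Function.invFun g ∘ α ∘ g


namespace WP
open Polynomial

section API
variable {R : Type} [CommRing R]

theorem rel : Wy R * Wx R = Wx R * Wy R + 1 := by
  unfold Wx Wy
  rw [← map_mul, ← map_mul, ← map_one (RingQuot.mkAlgHom R (WeylRel R)), ← map_add]
  exact RingQuot.mkAlgHom_rel R WeylRel.rel

def lift {A : Type*} [Ring A] [Algebra R A] (s d : A) (h : d * s = s * d + 1) :
    Weyl R →ₐ[R] A :=
  RingQuot.liftAlgHom R ⟨FreeAlgebra.lift R ![s, d], by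
    intro a b hab
    cases hab
    simp [h]⟩

@[simp] theorem lift_x {A : Type*} [Ring A] [Algebra R A] (s d : A) (h : d * s = s * d + 1) :
    lift (R := R) s d h (Wx R) = s := by
  simp [lift, Wx]

@[simp] theorem lift_y {A : Type*} [Ring A] [Algebra R A] (s d : A) (h : d * s = s * d + 1) :
    lift (R := R) s d h (Wy R) = d := by
  simp [lift, Wy]

theorem ind {C : Weyl R → Prop} (hc : ∀ r, C (algebraMap R _ r)) (hx : C (Wx R)) (hy : C (Wy R))
    (ha : ∀ a b, C a → C b → C (a + b)) (hm : ∀ a b, C a → C b → C (a * b)) (a : Weyl R) : C a := by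
  obtain ⟨a, rfl⟩ := RingQuot.mkAlgHom_surjective R (WeylRel R) a
  induction a using FreeAlgebra.induction with
  | grade0 r => rw [AlgHom.commutes]; exact hc r
  | grade1 i => fin_cases i; exacts [hx, hy]
  | mul a b h1 h2 => rw [map_mul]; exact hm _ _ h1 h2
  | add a b h1 h2 => rw [map_add]; exact ha _ _ h1 h2

theorem hom_ext {A : Type*} [Ring A] [Algebra R A] {f g : Weyl R →ₐ[R] A}
    (hx : f (Wx R) = g (Wx R)) (hy : f (Wy R) = g (Wy R)) : f = g := by
  refine AlgHom.ext fun a => ?_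
  induction a using ind with
  | hc r => simp
  | hx => exact hx
  | hy => exact hy
  | ha a b h1 h2 => simp [h1, h2]
  | hm a b h1 h2 => simp [h1, h2]

def Xop (R : Type) [CommRing R] : Module.End R R[X][X] := LinearMap.mulLeft R (X : R[X][X])
def Yop (R : Type) [CommRing R] : Module.End R R[X][X] := LinearMap.mulLeft R (C X : R[X][X]) +
  (derivative : R[X][X] →ₗ[R[X]] R[X][X]).restrictScalars R

@[simp] theorem Xop_apply (g : R[X][X]) : Xop R g = X * g := rfl
@[simp] theorem Yop_apply (g : R[X][X]) : Yop R g = C X * g + derivative g := rfl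

def rho (R : Type) [CommRing R] : Weyl R →ₐ[R] Module.End R R[X][X] :=
  lift (Xop R) (Yop R) (by
    ext1 g
    simp [Module.End.mul_apply]
    ring)

@[simp] theorem rho_x : rho R (Wx R) = Xop R := by simp [rho]
@[simp] theorem rho_y : rho R (Wy R) = Yop R := by simp [rho]

def cf (a : Weyl R) : R[X][X] := rho R a 1

theorem cf_mul (a b : Weyl R) : cf (a * b) = rho R a (cf b) := by
  simp [cf, Module.End.mul_apply]

theorem cf_add (a b : Weyl R) : cf (a + b) = cf a + cf b := by simp [cf]
theorem cf_sub (a b : Weyl R) : cf (a - b) = cf a - cf b := by simp [cf]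
theorem cf_neg (a : Weyl R) : cf (- a) = - cf a := by simp [cf]
theorem cf_smul (r : R) (a : Weyl R) : cf (r • a) = r • cf a := by simp [cf]
theorem cf_one : cf (1 : Weyl R) = 1 := by simp [cf]
theorem cf_zero : cf (0 : Weyl R) = 0 := by simp [cf]
theorem cf_sum {ι : Type*} (s : Finset ι) (g : ι → Weyl R) :
    cf (∑ i ∈ s, g i) = ∑ i ∈ s, cf (g i) := by
  simp [cf, map_sum, LinearMap.sum_apply]

theorem comm_pow {A : Type*} [Ring A] {s d : A} (h : d * s = s * d + 1) (n : ℕ) :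
    d * s ^ (n+1) = s ^ (n+1) * d + (n + 1 : ℕ) * s ^ n := by
  induction n with
  | zero => simp [h]
  | succ n ih =>
    rw [pow_succ s (n+1), ← mul_assoc, ih, add_mul, mul_assoc, h, mul_add, ← mul_assoc, ← pow_succ,
      mul_assoc _ _ s, ← pow_succ, mul_one]
    push_cast; noncomm_ring

theorem comm_pow' {A : Type*} [Ring A] {s d : A} (h : d * s = s * d + 1) (n : ℕ) :
    d ^ (n+1) * s = s * d ^ (n+1) + (n + 1 : ℕ) * d ^ n := by
  have := comm_pow (s := d) (d := - s) (by rw [mul_neg, neg_mul, h]; abel) n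
  rw [neg_mul, mul_neg, neg_eq_iff_add_eq_zero] at this
  rw [← sub_eq_zero, ← neg_eq_zero, ← this]
  abel

def LL (R : Type) [CommRing R] : R[X][X] →ₗ[R] Weyl R :=
  Polynomial.lsum (fun i => (LinearMap.mulLeft R (Wx R ^ i)) ∘ₗ (aeval (Wy R)).toLinearMap)

theorem LL_monomial (i : ℕ) (c : R[X]) : LL R (monomial i c) = Wx R ^ i * aeval (Wy R) c := by
  simp [LL, Polynomial.lsum_apply, sum_monomial_index]

theorem LL_X (g : R[X][X]) : LL R (X * g) = Wx R * LL R g := by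
  induction g using Polynomial.induction_on' with
  | add p q hp hq => simp [mul_add, hp, hq]
  | monomial i c => rw [X_mul_monomial, LL_monomial, LL_monomial, pow_succ', mul_assoc]

theorem LL_Y (g : R[X][X]) : LL R (Yop R g) = Wy R * LL R g := by
  induction g using Polynomial.induction_on' with
  | add p q hp hq => simp only [map_add, mul_add, hp, hq]
  | monomial i c =>
    rw [Yop_apply, C_mul_monomial, map_add, LL_monomial, LL_monomial, derivative_monomial, LL_monomial]
    rcases i with _ | i
    · simp
    · rw [← mul_assoc (Wy R), comm_pow rel]
      simp only [map_mul, aeval_X, map_natCast, Nat.add_sub_cancel]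
      rw [add_mul, mul_assoc _ (Wy R), mul_assoc, Nat.cast_comm, mul_assoc, ← Nat.cast_comm]

theorem LL_rho (a : Weyl R) : ∀ g, LL R (rho R a g) = a * LL R g := by
  induction a using ind with
  | hc r => intro g; simp [Algebra.algebraMap_eq_smul_one]
  | hx => intro g; simp [LL_X]
  | hy => intro g; rw [rho_y, LL_Y]
  | ha a b h1 h2 => intro g; simp [h1, h2, add_mul]
  | hm a b h1 h2 => intro g; simp [h1, h2, mul_assoc, Module.End.mul_apply]

theorem LL_one : LL R 1 = 1 := by
  have := LL_monomial (R := R) 0 1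
  simpa using this

@[simp] theorem LL_cf (a : Weyl R) : LL R (cf a) = a := by
  rw [cf, LL_rho, LL_one, mul_one]

theorem cf_inj {a b : Weyl R} (h : cf a = cf b) : a = b := by
  rw [← LL_cf a, h, LL_cf]

theorem rho_xy (i j : ℕ) : cf (Wx R ^ i * Wy R ^ j) = monomial i (X ^ j) := by
  induction i with
  | zero =>
    induction j with
    | zero => simp [cf_one]
    | succ j ih =>
      rw [pow_zero, one_mul] at ih ⊢
      rw [pow_succ', cf_mul, ih, rho_y, Yop_apply]
      rw [C_mul_monomial, derivative_monomial, pow_succ']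
      simp
  | succ i ih =>
    rw [pow_succ', mul_assoc, cf_mul, ih, rho_x, Xop_apply, X_mul_monomial]

theorem rho_alg (c : R[X]) : cf (aeval (Wy R) c) = C c := by
  induction c using Polynomial.induction_on' with
  | add p q hp hq => simp [hp, hq, cf_add]
  | monomial i c =>
    have := rho_xy (R := R) 0 i
    rw [pow_zero, one_mul] at this
    rw [aeval_monomial, ← Algebra.smul_def, cf_smul, this, monomial_zero_left, smul_C,
      ← smul_X_eq_monomial]

@[simp] theorem cf_LL (g : R[X][X]) : cf (LL R g) = g := by
  induction g using Polynomial.induction_on' with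
  | add p q hp hq => simp [cf_add, hp, hq]
  | monomial i c =>
    rw [LL_monomial]
    induction i with
    | zero => simp [rho_alg]
    | succ i ih => rw [pow_succ', mul_assoc, cf_mul, ih, rho_x, Xop_apply, X_mul_monomial]

/-- coefficient -/
def co (a : Weyl R) (u : ℕ × ℕ) : R := ((cf a).coeff u.1).coeff u.2

theorem co_ext {a b : Weyl R} (h : ∀ u, co a u = co b u) : a = b := by
  apply cf_inj
  ext i j
  exact h (i, j)

theorem co_add (a b : Weyl R) (u) : co (a + b) u = co a u + co b u := by simp [co, cf_add]
theorem co_sub (a b : Weyl R) (u) : co (a - b) u = co a u - co b u := by simp [co, cf_sub]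
theorem co_neg (a : Weyl R) (u) : co (-a) u = - co a u := by simp [co, cf_neg]
theorem co_smul (r : R) (a : Weyl R) (u) : co (r • a) u = r * co a u := by simp [co, cf_smul]
theorem co_zero (u) : co (0 : Weyl R) u = 0 := by simp [co, cf_zero]
theorem co_sum {ι : Type*} (s : Finset ι) (g : ι → Weyl R) (u) :
    co (∑ i ∈ s, g i) u = ∑ i ∈ s, co (g i) u := by
  simp [co, cf_sum, finsetSum_coeff]

theorem co_xy (i j : ℕ) (u) : co (Wx R ^ i * Wy R ^ j) u = if u = (i, j) then 1 else 0 := by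
  obtain ⟨k, l⟩ := u
  simp only [co, rho_xy, coeff_monomial, Prod.mk.injEq]
  by_cases h : i = k
  · simp [h, coeff_X_pow]
  · simp [h, Ne.symm h]

theorem rho_comm_x (a : Weyl R) (u) : co (a * Wx R - Wx R * a) u = (u.2 + 1 : ℕ) * co a (u.1, u.2+1) := by
  rw [← LL_cf a]
  generalize cf a = g
  induction g using Polynomial.induction_on' with
  | add p q hp hq =>
    rw [map_add, co_add, mul_add (_ : R), ← hp, ← hq, ← co_add]
    congr 1; noncomm_ring
  | monomial i c =>
  induction c using Polynomial.induction_on' with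
  | add p q hp hq =>
    rw [map_add, map_add, co_add, mul_add (_ : R), ← hp, ← hq, ← co_add]
    congr 1; noncomm_ring
  | monomial j c =>
    rw [LL_monomial, aeval_monomial, ← Algebra.smul_def, mul_smul_comm, co_smul, smul_mul_assoc,
      mul_smul_comm, co_sub, co_smul, co_smul, ← mul_sub, ← co_sub]
    have key : Wy R ^ j * Wx R = Wx R * Wy R ^ j + (j : R) • Wy R ^ (j - 1) := by
      rcases j with _ | j
      · simp
      · rw [comm_pow' rel, Algebra.smul_def, map_natCast, Nat.add_sub_cancel]
    rw [mul_assoc, key, mul_add, ← mul_assoc, ← mul_assoc, ← pow_succ, ← pow_succ', add_sub_cancel_left,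
      mul_smul_comm, co_smul, co_xy, co_xy]
    rcases j with _ | j
    · simp
    · obtain ⟨k, l⟩ := u
      simp only [Nat.add_sub_cancel, Prod.mk.injEq, Nat.add_right_cancel_iff]
      split_ifs with h
      · obtain ⟨rfl, rfl⟩ := h; ring
      · ring

theorem rho_comm_y (a : Weyl R) (u) : co (Wy R * a - a * Wy R) u = (u.1 + 1 : ℕ) * co a (u.1+1, u.2) := by
  rw [← LL_cf a]
  generalize cf a = g
  induction g using Polynomial.induction_on' with
  | add p q hp hq =>
    rw [map_add, co_add, mul_add (_ : R), ← hp, ← hq, ← co_add]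
    congr 1; noncomm_ring
  | monomial i c =>
  induction c using Polynomial.induction_on' with
  | add p q hp hq =>
    rw [map_add, map_add, co_add, mul_add (_ : R), ← hp, ← hq, ← co_add]
    congr 1; noncomm_ring
  | monomial j c =>
    rw [LL_monomial, aeval_monomial, ← Algebra.smul_def, mul_smul_comm, co_smul, smul_mul_assoc,
      mul_smul_comm, co_sub, co_smul, co_smul, ← mul_sub, ← co_sub]
    have key : Wy R * Wx R ^ i = Wx R ^ i * Wy R + (i : R) • Wx R ^ (i - 1) := by
      rcases i with _ | i
      · simp
      · rw [comm_pow rel, Algebra.smul_def, map_natCast, Nat.add_sub_cancel]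
    rw [← mul_assoc, key, add_mul, mul_assoc, ← pow_succ', mul_assoc, ← pow_succ, add_sub_cancel_left,
      smul_mul_assoc, co_smul, co_xy, co_xy]
    rcases i with _ | i
    · simp
    · obtain ⟨k, l⟩ := u
      simp only [Nat.add_sub_cancel, Prod.mk.injEq, Nat.add_right_cancel_iff]
      split_ifs with h
      · obtain ⟨rfl, rfl⟩ := h; ring
      · ring

/-- base change -/
def mapW (R R' : Type) [CommRing R] [CommRing R'] [Algebra R R'] : Weyl R →ₐ[R] Weyl R' :=
  lift (Wx R') (Wy R') rel

variable {R' : Type} [CommRing R'] [Algebra R R']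

@[simp] theorem mapW_x : mapW R R' (Wx R) = Wx R' := by simp [mapW]
@[simp] theorem mapW_y : mapW R R' (Wy R) = Wy R' := by simp [mapW]

theorem rho_map (a : Weyl R) : ∀ g : R[X][X],
    rho R' (mapW R R' a) (g.map (mapRingHom (algebraMap R R')))
      = (rho R a g).map (mapRingHom (algebraMap R R')) := by
  induction a using ind with
  | hc r =>
    intro g
    rw [AlgHom.commutes, AlgHom.commutes, IsScalarTower.algebraMap_apply R R' (Weyl R'), AlgHom.commutes]
    rw [Module.algebraMap_end_apply, Module.algebraMap_end_apply]
    ext i j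
    simp [coeff_smul]
  | hx => intro g; simp
  | hy => intro g; simp [derivative_map]
  | ha a b h1 h2 => intro g; simp [h1, h2]
  | hm a b h1 h2 => intro g; simp [h1, h2, Module.End.mul_apply]

theorem co_map (a : Weyl R) (u) : co (mapW R R' a) u = algebraMap R R' (co a u) := by
  have := rho_map (R' := R') a 1
  simp only [Polynomial.map_one] at this
  simp [co, cf, this]

theorem mapW_inj (h : Function.Injective (algebraMap R R')) : Function.Injective (mapW R R') := by
  intro a b hab
  apply co_ext
  intro u
  apply h
  rw [← co_map, ← co_map, hab]

end API
end WP

namespace WP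
open Polynomial

section Deg
variable {R : Type} [CommRing R]

theorem rho_aeval (c : R[X]) : rho R (aeval (Wy R) c) = aeval (Yop R) c := by
  rw [← aeval_algHom_apply, rho_y]

theorem rho_xpow (i : ℕ) (g : R[X][X]) : rho R (Wx R ^ i) g = X ^ i * g := by
  induction i with
  | zero => simp
  | succ i ih => rw [pow_succ', map_mul, Module.End.mul_apply, ih, rho_x, Xop_apply, pow_succ', mul_assoc]

theorem Ypow_deg (j : ℕ) (g : R[X][X]) (n : ℕ) (hg : g.natDegree ≤ n) :
    ((Yop R ^ j) g).natDegree ≤ n ∧ ((Yop R ^ j) g).coeff n = X ^ j * g.coeff n := by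
  induction j with
  | zero => simp [hg]
  | succ j ih =>
    rw [pow_succ', Module.End.mul_apply, Yop_apply]
    set h := (Yop R ^ j) g
    have hd : (derivative h).natDegree ≤ n - 1 := (natDegree_derivative_le h).trans (by omega)
    constructor
    · refine natDegree_add_le_of_degree_le ((natDegree_C_mul_le _ _).trans ih.1) (hd.trans (by omega))
    · rw [coeff_add, coeff_C_mul, ih.2, coeff_derivative,
        coeff_eq_zero_of_natDegree_lt (by omega : h.natDegree < n + 1)]
      ring

theorem Yc_deg (c : R[X]) (g : R[X][X]) (n : ℕ) (hg : g.natDegree ≤ n) :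
    (aeval (Yop R) c g).natDegree ≤ n ∧ (aeval (Yop R) c g).coeff n = c * g.coeff n := by
  induction c using Polynomial.induction_on' with
  | add p q hp hq =>
    rw [map_add, LinearMap.add_apply, coeff_add, hp.2, hq.2, add_mul]
    exact ⟨natDegree_add_le_of_degree_le hp.1 hq.1, rfl⟩
  | monomial j r =>
    obtain ⟨h1, h2⟩ := Ypow_deg j g n hg
    rw [aeval_monomial, ← Algebra.smul_def, LinearMap.smul_apply, coeff_smul, h2,
      ← smul_X_eq_monomial]
    refine ⟨(natDegree_smul_le _ _).trans h1, ?_⟩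
    simp

theorem rho_sum (a : Weyl R) (g : R[X][X]) (n : ℕ) (ha : (cf a).natDegree ≤ n) :
    rho R a g = ∑ i ∈ Finset.range (n+1), X ^ i * aeval (Yop R) ((cf a).coeff i) g := by
  conv_lhs => rw [← LL_cf a, (cf a).as_sum_range' (n+1) (by omega)]
  rw [map_sum, map_sum, LinearMap.sum_apply]
  refine Finset.sum_congr rfl fun i _ => ?_
  rw [LL_monomial, map_mul, Module.End.mul_apply, rho_aeval, rho_xpow]

theorem top_mul (a b : Weyl R) (n m : ℕ) (ha : (cf a).natDegree ≤ n) (hb : (cf b).natDegree ≤ m) :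
    (cf (a * b)).natDegree ≤ n + m ∧
      (cf (a * b)).coeff (n + m) = (cf a).coeff n * (cf b).coeff m := by
  rw [cf_mul, rho_sum a _ n ha]
  constructor
  · apply natDegree_sum_le_of_forall_le
    intro i hi
    rw [Finset.mem_range] at hi
    refine natDegree_mul_le.trans (add_le_add ((natDegree_X_pow_le i).trans (by omega)) (Yc_deg _ _ m hb).1)
  · rw [finsetSum_coeff, Finset.sum_eq_single n]
    · rw [add_comm n m, coeff_X_pow_mul, (Yc_deg _ _ m hb).2]
    · intro i hi hne
      rw [Finset.mem_range] at hi
      rw [coeff_X_pow_mul', if_pos (by omega)]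
      apply coeff_eq_zero_of_natDegree_lt
      have := (Yc_deg ((cf a).coeff i) _ m hb).1
      omega
    · simp

theorem top_pow (a : Weyl R) (n : ℕ) (ha : (cf a).natDegree ≤ n) (q : ℕ) :
    (cf (a ^ q)).natDegree ≤ q * n ∧
      (cf (a ^ q)).coeff (q * n) = (cf a).coeff n ^ q := by
  induction q with
  | zero => simp [cf_one]
  | succ q ih =>
    rw [pow_succ a, pow_succ ((cf a).coeff n), add_mul, one_mul, ← ih.2]
    exact top_mul _ _ _ _ ih.1 ha

def Pd (m : ℕ) (g : R[X][X]) : Prop := ∀ i, (g.coeff i).natDegree ≤ m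

theorem Pd.mono {m m' : ℕ} {g : R[X][X]} (h : Pd m g) (hm : m ≤ m') : Pd m' g :=
  fun i => (h i).trans hm

theorem Pd.sum {ι : Type*} (s : Finset ι) {m : ℕ} {g : ι → R[X][X]} (h : ∀ i ∈ s, Pd m (g i)) :
    Pd m (∑ i ∈ s, g i) := by
  intro k
  rw [finsetSum_coeff]
  exact natDegree_sum_le_of_forall_le _ _ fun i hi => h i hi k

theorem Ypow_Pd (j m : ℕ) (g : R[X][X]) (hg : Pd m g) : Pd (j + m) ((Yop R ^ j) g) := by
  induction j with
  | zero => simpa using hg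
  | succ j ih =>
    intro i
    rw [pow_succ', Module.End.mul_apply, Yop_apply]
    set h := (Yop R ^ j) g
    rw [coeff_add, coeff_C_mul, coeff_derivative]
    apply natDegree_add_le_of_degree_le
    · have := ih i
      refine natDegree_mul_le.trans ?_
      have := natDegree_X_le (R := R)
      omega
    · refine natDegree_mul_le.trans ?_
      have := ih (i + 1)
      have h2 : ((i : R[X]) + 1).natDegree = 0 := by
        rw [← Nat.cast_one, ← Nat.cast_add]; exact natDegree_natCast _
      omega

theorem Pd_mul (a b : Weyl R) (n m : ℕ) (ha : Pd n (cf a)) (hb : Pd m (cf b)) :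
    Pd (n + m) (cf (a * b)) := by
  rw [cf_mul, rho_sum a _ _ le_rfl]
  apply Pd.sum
  intro i _ k
  rw [coeff_X_pow_mul']
  split_ifs
  swap
  · simp
  generalize k - i = k
  have : Pd (n + m) (aeval (Yop R) ((cf a).coeff i) (cf b)) := by
    rw [((cf a).coeff i).as_sum_range' (n + 1) (by have := ha i; omega), map_sum, LinearMap.sum_apply]
    apply Pd.sum
    intro j hj l
    rw [Finset.mem_range] at hj
    rw [aeval_monomial, ← Algebra.smul_def, LinearMap.smul_apply, coeff_smul]
    have := Ypow_Pd j m _ hb l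
    exact (natDegree_smul_le _ _).trans (by omega)
  exact this k

/-- box bound -/
def Bd (N : ℕ) (a : Weyl R) : Prop := (cf a).natDegree ≤ N ∧ Pd N (cf a)

theorem Bd.mul {N M : ℕ} {a b : Weyl R} (ha : Bd N a) (hb : Bd M b) : Bd (N + M) (a * b) :=
  ⟨(top_mul a b _ _ ha.1 hb.1).1, Pd_mul a b _ _ ha.2 hb.2⟩

theorem Bd.pow {N : ℕ} {a : Weyl R} (ha : Bd N a) (q : ℕ) : Bd (q * N) (a ^ q) := by
  induction q with
  | zero =>
    refine ⟨by simp [cf_one], fun i => ?_⟩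
    rw [pow_zero, cf_one, coeff_one]; split_ifs <;> simp
  | succ q ih => rw [pow_succ, add_mul, one_mul]; exact ih.mul ha

theorem Bd.co {N : ℕ} {a : Weyl R} (ha : Bd N a) {u : ℕ × ℕ} (h : co a u ≠ 0) : u.1 ≤ N ∧ u.2 ≤ N := by
  constructor
  · by_contra hu
    exact h (by rw [WP.co, coeff_eq_zero_of_natDegree_lt (p := cf a) (by have := ha.1; omega), coeff_zero])
  · by_contra hu
    exact h (by rw [WP.co, coeff_eq_zero_of_natDegree_lt (by have := ha.2 u.1; omega)])

theorem Bd_of_co {N : ℕ} {a : Weyl R} (h : ∀ u, WP.co a u ≠ 0 → u.1 ≤ N ∧ u.2 ≤ N) : Bd N a := by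
  constructor
  · rw [natDegree_le_iff_coeff_eq_zero]
    intro i hi
    ext j
    by_contra hu
    have := h (i, j) hu
    simp at this; omega
  · intro i
    rw [natDegree_le_iff_coeff_eq_zero]
    intro j hj
    by_contra hu
    have := h (i, j) hu
    simp at this; omega

theorem exists_Bd (a : Weyl R) : ∃ N, Bd N a := by
  refine ⟨(cf a).natDegree + (cf a).support.sup (fun i => ((cf a).coeff i).natDegree), by omega, fun i => ?_⟩
  by_cases h : i ∈ (cf a).support
  · have := Finset.le_sup (f := fun i => ((cf a).coeff i).natDegree) h
    omega
  · rw [notMem_support_iff.1 h]; simp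

theorem Bd.mono {N M : ℕ} {a : Weyl R} (h : Bd N a) (hNM : N ≤ M) : Bd M a :=
  ⟨h.1.trans hNM, h.2.mono hNM⟩

def box (N : ℕ) : Finset (ℕ × ℕ) := Finset.range (N+1) ×ˢ Finset.range (N+1)

theorem mem_box {N : ℕ} {u : ℕ × ℕ} : u ∈ box N ↔ u.1 ≤ N ∧ u.2 ≤ N := by
  simp [box, Nat.lt_succ_iff]

/-- lex-top coefficient -/
theorem exists_top (a : Weyl R) (ha : a ≠ 0) : ∃ n m, co a (n, m) ≠ 0 ∧
    (∀ u, co a u ≠ 0 → u.1 < n ∨ (u.1 = n ∧ u.2 ≤ m)) := by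
  have h0 : cf a ≠ 0 := fun h => ha (cf_inj (by rw [h, cf_zero]))
  refine ⟨(cf a).natDegree, (cf a).leadingCoeff.natDegree, ?_, ?_⟩
  · have : (cf a).leadingCoeff ≠ 0 := leadingCoeff_ne_zero.2 h0
    exact leadingCoeff_ne_zero.2 this
  · intro u hu
    by_contra hc
    push Not at hc
    rcases lt_or_eq_of_le hc.1 with h | h
    · exact hu (by rw [WP.co, coeff_eq_zero_of_natDegree_lt h, coeff_zero])
    · refine hu ?_
      rw [WP.co, ← h]
      exact coeff_eq_zero_of_natDegree_lt (hc.2 h.symm)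

theorem co_top_pow (a : Weyl R) (n m : ℕ) 
    (h : ∀ u, co a u ≠ 0 → u.1 < n ∨ (u.1 = n ∧ u.2 ≤ m)) (q : ℕ) :
    co (a ^ q) (q * n, q * m) = co a (n, m) ^ q := by
  have h1 : (cf a).natDegree ≤ n := by
    rw [natDegree_le_iff_coeff_eq_zero]
    intro i hi
    ext j
    by_contra hu
    have := h (i, j) hu
    simp at this; omega
  have h2 : ((cf a).coeff n).natDegree ≤ m := by
    rw [natDegree_le_iff_coeff_eq_zero]
    intro j hj
    by_contra hu
    have := h (n, j) hu
    simp at this; omega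
  rw [WP.co, WP.co, (top_pow a n h1 q).2]
  simp only
  rw [coeff_pow_of_natDegree_le h2]

end Deg
end WP

namespace WP
noncomputable section
open Polynomial

section Mat

theorem comp_eps {S : Type*} [CommRing S] (p : S[X]) (e : S) (he : e * e = 0) :
    p.comp (X + C e) = p + derivative p * C e := by
  have := aeval_add_of_sq_eq_zero p (X : S[X]) (C e) (by rw [sq, ← C_mul, he, C_0])
  simpa [comp, aeval_def, algebraMap_eq] using this

theorem charpoly_eps {S : Type*} [CommRing S] {n : Type*} [Fintype n] [DecidableEq n]
    (M N : Matrix n n S) (e : S) (he : e * e = 0)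
    (h : M * N = N * M + 1) : derivative M.charpoly * C e = 0 := by
  have h0 : (e • N) * (e • N) = 0 := by rw [smul_mul_smul_comm, he, zero_smul]
  have hu1 : (1 - e • N) * (1 + e • N) = 1 := by
    rw [mul_add, sub_mul, sub_mul, mul_one, mul_one, one_mul, h0]; abel
  have hu2 : (1 + e • N) * (1 - e • N) = 1 := by
    rw [mul_sub, add_mul, add_mul, mul_one, mul_one, one_mul, h0]; abel
  let u : (Matrix n n S)ˣ := ⟨_, _, hu1, hu2⟩
  have hs : Matrix.scalar n e = e • (1 : Matrix n n S) := by
    ext a b; simp [Matrix.one_apply, Matrix.diagonal_apply]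
  have h1 : (1 - e • N) * (M - Matrix.scalar n e) = M * (1 - e • N) := by
    rw [hs, mul_sub, mul_sub, sub_mul, sub_mul, smul_mul_smul_comm, he, zero_smul, one_mul, one_mul,
      mul_one, mul_smul_comm, h, smul_add, smul_mul_assoc]
    abel
  have h2 : (u : Matrix n n S) * (M - Matrix.scalar n e) * (u⁻¹ : (Matrix n n S)ˣ) = M := by
    change (1 - e • N) * (M - Matrix.scalar n e) * (1 + e • N) = M
    rw [h1, mul_assoc, hu1, mul_one]
  have h3 := Matrix.charpoly_units_conj u (M - Matrix.scalar n e)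
  rw [Matrix.coe_units_inv] at h2
  rw [h2, Matrix.charpoly_sub_scalar, comp_eps _ _ he] at h3
  exact left_eq_add.1 h3

variable {T : Type*} [CommRing T]

theorem charpoly_deriv {n : Type*} [Fintype n] [DecidableEq n] (M N : Matrix n n T)
    (h : M * N = N * M + 1) : derivative M.charpoly = 0 := by
  let i : T →+* DualNumber T := TrivSqZeroExt.inlHom T T
  have h' : M.map i * N.map i = N.map i * M.map i + 1 := by
    have := congrArg (fun A : Matrix n n T => A.map i) h
    simp only [Matrix.map_mul] at this
    rw [this, Matrix.map_add _ (map_add i), Matrix.map_mul, Matrix.map_one _ (map_zero i) (map_one i)]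
  have := charpoly_eps _ _ (DualNumber.eps : DualNumber T) DualNumber.eps_mul_eps h'
  rw [Matrix.charpoly_map, derivative_map] at this
  ext k
  have h2 := congrArg (fun q => TrivSqZeroExt.snd (q.coeff k)) this
  simpa [i] using h2

theorem unit_of_lt {p : ℕ} (hp : p.Prime) (hT : (p : T) = 0) {i : ℕ} (h0 : 0 < i) (hi : i < p) :
    ∃ b : T, b * i = 1 := by
  have : IsCoprime (i : ℤ) (p : ℤ) :=
    Nat.isCoprime_iff_coprime.2 ((Nat.coprime_comm.1 ((Nat.Prime.coprime_iff_not_dvd hp).2 fun hd => absurd (Nat.le_of_dvd h0 hd) (by omega))))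
  obtain ⟨a, b, hab⟩ := this
  refine ⟨a, ?_⟩
  have := congrArg (Int.cast : ℤ → T) hab
  push_cast at this
  rw [hT, mul_zero, add_zero] at this
  exact this

theorem pow_scalar {p : ℕ} (hp : p.Prime) (hT : (p : T) = 0) (M N : Matrix (Fin p) (Fin p) T)
    (h : M * N = N * M + 1) : ∃ c : T, M ^ p = c • 1 := by
  nontriviality T
  have hd := charpoly_deriv M N h
  have hdeg : M.charpoly.natDegree = p := by rw [Matrix.charpoly_natDegree_eq_dim, Fintype.card_fin]
  have hc : ∀ i, 0 < i → i < p → M.charpoly.coeff i = 0 := by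
    intro i h0 hi
    obtain ⟨b, hb⟩ := unit_of_lt hp hT h0 hi
    have := congrArg (fun q => q.coeff (i-1)) hd
    simp only [coeff_derivative, coeff_zero] at this
    rw [Nat.sub_add_cancel h0, ← Nat.cast_succ, Nat.succ_eq_add_one, Nat.sub_add_cancel h0] at this
    calc _ = b * i * M.charpoly.coeff i := by rw [hb, one_mul]
      _ = b * (M.charpoly.coeff i * i) := by ring
      _ = 0 := by rw [this, mul_zero]
  have hm : M.charpoly.coeff p = 1 := by
    have := M.charpoly_monic.coeff_natDegree
    rwa [hdeg] at this
  have := M.aeval_self_charpoly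
  rw [aeval_eq_sum_range' (n := p + 1) (by omega), Finset.sum_range_succ, hm, one_smul,
    Finset.sum_eq_single 0] at this
  · refine ⟨- M.charpoly.coeff 0, ?_⟩
    rw [pow_zero] at this
    rw [neg_smul]
    exact (neg_eq_of_add_eq_zero_right this).symm
  · intro i hi h0
    rw [hc i (by omega) (Finset.mem_range.1 hi), zero_smul]
  · intro h; exact absurd (Finset.mem_range.2 hp.pos) h

end Mat

section Rep
variable {R : Type} [CommRing R] (p : ℕ)

def XM (R : Type) [CommRing R] (p : ℕ) : Matrix (Fin p) (Fin p) R[X][X] := fun i j =>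
  if i.1 = j.1 + 1 then 1 else if i.1 = 0 ∧ j.1 + 1 = p then X else 0

def YM (R : Type) [CommRing R] (p : ℕ) : Matrix (Fin p) (Fin p) R[X][X] := fun i j =>
  if i = j then C X else if i.1 + 1 = j.1 then (j.1 : R[X][X]) else 0

open Matrix in
theorem XM_mulVec (v : Fin p → R[X][X]) (i : Fin p) :
    (XM R p *ᵥ v) i = if h : i.1 = 0 then X * v ⟨p - 1, by omega⟩ else v ⟨i.1 - 1, by omega⟩ := by
  simp only [mulVec, dotProduct, XM]
  split_ifs with h
  · rw [Finset.sum_eq_single ⟨p - 1, by omega⟩]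
    · rw [if_neg (by omega), if_pos ⟨h, by simp only; omega⟩]
    · intro b _ hb
      rw [if_neg (by omega), if_neg, zero_mul]
      rintro ⟨_, h2⟩
      exact hb (Fin.ext (by simp only; omega))
    · simp
  · rw [Finset.sum_eq_single ⟨i.1 - 1, by omega⟩]
    · rw [if_pos (by simp only; omega), one_mul]
    · intro b _ hb
      rw [if_neg, if_neg (by omega), zero_mul]
      intro h2
      exact hb (Fin.ext (by simp only; omega))
    · simp

open Matrix in
theorem YM_mulVec (v : Fin p → R[X][X]) (i : Fin p) :
    (YM R p *ᵥ v) i = C X * v i + if h : i.1 + 1 < p then (i.1 + 1 : ℕ) * v ⟨i.1 + 1, h⟩ else 0 := by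
  have h1 : ∀ j : Fin p, YM R p i j * v j = (if i = j then C X * v j else 0) +
      (if i.1 + 1 = j.1 then (j.1 : R[X][X]) * v j else 0) := by
    intro j
    unfold YM
    by_cases h : i = j
    · subst h; simp
    · simp [h]
  simp only [mulVec, dotProduct]
  rw [Finset.sum_congr rfl (fun j _ => h1 j), Finset.sum_add_distrib, Finset.sum_ite_eq,
    if_pos (Finset.mem_univ _)]
  congr 1
  split_ifs with h
  · rw [Finset.sum_eq_single ⟨i.1 + 1, h⟩]
    · simp
    · intro b _ hb
      rw [if_neg]
      intro h2
      exact hb (Fin.ext (by simp only; omega))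
    · simp
  · apply Finset.sum_eq_zero
    intro j _
    rw [if_neg (by omega)]

theorem XYM (hp2 : 1 < p) (hR : (p : R) = 0) : YM R p * XM R p = XM R p * YM R p + 1 := by
  have hT : (p : R[X][X]) = 0 := by
    have := congrArg (fun r : R => (C (C r) : R[X][X])) hR
    simpa using this
  apply Matrix.ext_of_mulVec_single
  intro j
  ext1 i
  rw [Matrix.add_mulVec, ← Matrix.mulVec_mulVec, ← Matrix.mulVec_mulVec, Matrix.one_mulVec,
    Pi.add_apply]
  generalize (Pi.single j 1 : Fin p → R[X][X]) = v
  rw [YM_mulVec, XM_mulVec, XM_mulVec]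
  by_cases hi : i.1 = 0
  · rw [dif_pos hi, dif_pos hi, YM_mulVec, dif_pos (by omega), dif_neg (by simp only; omega),
      XM_mulVec, dif_neg (by simp)]
    simp only [Nat.add_sub_cancel, Fin.eta]
    rw [show ((i.1 + 1 : ℕ) : R[X][X]) = 1 by simp [hi]]
    ring
  · rw [dif_neg hi, dif_neg hi, YM_mulVec, dif_pos (show i.1 - 1 + 1 < p by omega)]
    have e : (⟨i.1 - 1 + 1, by omega⟩ : Fin p) = i := Fin.ext (Nat.sub_add_cancel (by omega))
    simp only [e]
    rw [Nat.sub_add_cancel (by omega)]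
    by_cases hp : i.1 + 1 < p
    · rw [dif_pos hp, XM_mulVec, dif_neg (by simp)]
      simp only [Nat.add_sub_cancel, Fin.eta]
      push_cast; ring
    · rw [dif_neg hp]
      have h3 : ((i.1 : ℕ) : R[X][X]) + 1 = 0 := by
        rw [← hT, ← Nat.cast_succ]; congr 1; omega
      linear_combination (-v i) * h3

def repM (hp2 : 1 < p) (hR : (p : R) = 0) : Weyl R →ₐ[R] Matrix (Fin p) (Fin p) R[X][X] :=
  lift (XM R p) (YM R p) (XYM p hp2 hR)

/-- shift down by r -/
def Th (g : R[X][X]) (r : Fin p) : R[X][X] := contract p (divX^[r.1] g)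

theorem coeff_iter_divX (g : R[X][X]) (r n : ℕ) : (divX^[r] g).coeff n = g.coeff (n + r) := by
  induction r generalizing n with
  | zero => rfl
  | succ r ih => rw [Function.iterate_succ_apply', coeff_divX, ih]; congr 1; omega

theorem Th_coeff (hp : p ≠ 0) (g : R[X][X]) (r : Fin p) (k : ℕ) : (Th p g r).coeff k = g.coeff (k * p + r) := by
  rw [Th, coeff_contract hp, coeff_iter_divX]

open Matrix in
theorem Th_rho (hp2 : 1 < p) (hR : (p : R) = 0) (a : Weyl R) :
    ∀ g, Th p (rho R a g) = repM p hp2 hR a *ᵥ Th p g := by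
  have hp0 : p ≠ 0 := by omega
  induction a using ind with
  | hc r =>
    intro g; ext1 i; ext1 k
    rw [AlgHom.commutes, AlgHom.commutes, Module.algebraMap_end_apply,
      Algebra.algebraMap_eq_smul_one, smul_mulVec, one_mulVec, Pi.smul_apply, coeff_smul]
    simp only [Th_coeff p hp0, coeff_smul]
  | hx =>
    intro g; ext1 i; ext1 k
    rw [repM, lift_x, XM_mulVec, rho_x, Xop_apply, Th_coeff p hp0]
    split_ifs with h
    · rcases k with _ | k
      · simp [h]
      · rw [coeff_X_mul, Th_coeff p hp0, h, show (k+1)*p + 0 = (k * p + (p-1)) + 1 by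
          rw [add_mul]; omega, coeff_X_mul]
    · rw [Th_coeff p hp0]
      simp only
      rw [show k * p + i.1 = (k * p + (i.1 - 1)) + 1 by omega, coeff_X_mul]
  | hy =>
    have hT : (p : R[X]) = 0 := by
      have := congrArg (fun r : R => (C r : R[X])) hR
      simpa using this
    intro g; ext1 i; ext1 k
    rw [repM, lift_y, YM_mulVec, rho_y, Yop_apply, Th_coeff p hp0, coeff_add, coeff_add, coeff_C_mul,
      coeff_C_mul, Th_coeff p hp0, coeff_derivative]
    congr 1
    split_ifs with h
    · rw [← C_eq_natCast (R := R[X]) (i.1 + 1), coeff_C_mul, Th_coeff p hp0]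
      push_cast
      rw [hT]
      simp only [mul_zero, zero_add, add_assoc]
      ring
    · have h3 : ((k * p + i.1 : ℕ) : R[X]) + 1 = 0 := by
        have : i.1 + 1 = p := by omega
        rw [← Nat.cast_succ, Nat.succ_eq_add_one, add_assoc, this]
        push_cast
        rw [hT]; simp
      rw [h3]; simp
  | ha a b h1 h2 =>
    intro g
    rw [map_add, map_add, add_mulVec, ← h1, ← h2, LinearMap.add_apply]
    ext1 i; ext1 k
    simp [Th_coeff p hp0]
  | hm a b h1 h2 =>
    intro g
    rw [map_mul, map_mul, ← mulVec_mulVec, Module.End.mul_apply, h1, h2]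

theorem repM_inj (hp2 : 1 < p) (hR : (p : R) = 0) : Function.Injective (repM (R := R) p hp2 hR) := by
  intro a b hab
  apply cf_inj
  have : Th p (cf a) = Th p (cf b) := by
    rw [cf, cf, Th_rho p hp2 hR, hab, Th_rho p hp2 hR]
  ext1 n
  have h2 := congrArg (fun q => (q ⟨n % p, Nat.mod_lt _ (by omega)⟩).coeff (n / p)) this
  simp only [Th_coeff p (by omega : p ≠ 0)] at h2
  rwa [Nat.div_add_mod'] at h2

theorem central {p : ℕ} (hp : p.Prime) (hR : (p : R) = 0) (a b : Weyl R) (h : a * b = b * a + 1)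
    (x : Weyl R) : a ^ p * x = x * a ^ p := by
  apply repM_inj p hp.one_lt hR
  have hT : (p : R[X][X]) = 0 := by
    have := congrArg (fun r : R => (C (C r) : R[X][X])) hR
    simpa using this
  obtain ⟨c, hc⟩ := pow_scalar hp hT (repM p hp.one_lt hR a) (repM p hp.one_lt hR b)
    (by rw [← map_mul, h, map_add, map_mul, map_one])
  rw [map_mul, map_mul, map_pow, hc]
  simp

theorem central_co {p : ℕ} (hp : p.Prime) (hR : (p : R) = 0) (a : Weyl R)
    (h : ∀ x, a * x = x * a) (u : ℕ × ℕ) (hu : ¬ (p ∣ u.1 ∧ p ∣ u.2)) : co a u = 0 := by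
  have unit : ∀ n : ℕ, ¬ p ∣ n → ∀ z : R, n * z = 0 → z = 0 := by
    intro n hn z hz
    have hm : 0 < n % p := Nat.pos_of_ne_zero fun h0 => hn (Nat.dvd_of_mod_eq_zero h0)
    obtain ⟨b, hb⟩ := unit_of_lt hp hR hm (Nat.mod_lt _ hp.pos)
    have h1 : (n : R) = ((n % p : ℕ) : R) := by
      conv_lhs => rw [← Nat.mod_add_div n p]
      push_cast
      rw [hR]; simp
    rw [h1] at hz
    calc z = b * ((n % p : ℕ) : R) * z := by rw [hb, one_mul]
      _ = 0 := by rw [mul_assoc, hz, mul_zero]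
  obtain ⟨i, j⟩ := u
  by_cases hi : p ∣ i
  · have hj : ¬ p ∣ j := fun hj => hu ⟨hi, hj⟩
    rcases j with _ | j
    · exact absurd (dvd_zero p) hj
    have := rho_comm_x a (i, j)
    rw [h, sub_self, co_zero] at this
    exact unit _ hj _ this.symm
  · rcases i with _ | i
    · exact absurd (dvd_zero p) hi
    have := rho_comm_y a (i, j)
    rw [h, sub_self, co_zero] at this
    exact unit _ hi _ this.symm

end Rep
end
end WP

namespace WP
noncomputable section
open Polynomial

section Abs
variable {Λ A : Type*} [CommRing Λ] [Ring A] [Algebra Λ A] {P Q : A} {c : Λ}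

theorem ab1 (h : Q * P = P * Q + c • 1) (k : ℕ) :
    Q * P ^ (k+1) = P ^ (k+1) * Q + ((k + 1 : ℕ) * c) • P ^ k := by
  induction k with
  | zero => simp [h]
  | succ k ih =>
    rw [pow_succ P (k+1), ← mul_assoc, ih, add_mul, mul_assoc, h, mul_add, ← mul_assoc,
      smul_mul_assoc, ← pow_succ, ← pow_succ, mul_smul_comm, mul_one, add_assoc, ← add_smul]
    congr 2
    push_cast; ring

theorem ab2 (h : Q * P = P * Q + c • 1) (hc : c * c = 0) (k : ℕ) :
    c • (Q * P ^ k) = c • (P ^ k * Q) := by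
  rcases k with _ | k
  · simp
  · rw [ab1 h, smul_add, smul_smul, mul_left_comm, hc]; simp

theorem ab3 (h : Q * P = P * Q + c • 1) (hc : c * c = 0) (j k : ℕ) :
    P * (Q ^ j * P ^ k * Q) = P * (P ^ k * Q ^ (j+1)) + (j * k * c) • (P ^ k * Q ^ j) := by
  rcases k with _ | k
  · simp [pow_succ]
  have : Q ^ j * P ^ (k+1) * Q = P ^ (k+1) * Q ^ (j+1) + (j * (k+1 : ℕ) * c) • (P ^ k * Q ^ j) := by
    induction j with
    | zero => simp
    | succ j ih =>
      have hcq : ((j : Λ) * (k+1 : ℕ) * c) • (Q * P ^ k) = ((j : Λ) * (k+1 : ℕ) * c) • (P ^ k * Q) := by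
        rw [mul_smul, ab2 h hc, ← mul_smul]
      rw [pow_succ' Q j, mul_assoc, mul_assoc, ← mul_assoc (Q ^ j), ih, mul_add, ← mul_assoc, ab1 h,
        mul_smul_comm, ← mul_assoc Q, ← smul_mul_assoc, hcq, add_mul, smul_mul_assoc,
        smul_mul_assoc, mul_assoc (P ^ k), ← pow_succ' Q j, mul_assoc _ Q, ← pow_succ', add_assoc, ← add_smul]
      congr 2
      push_cast; ring
  rw [this, mul_add, mul_smul_comm, ← mul_assoc P (P ^ k), ← pow_succ']

theorem ab4 (h : Q * P = P * Q + c • 1) (hc : c * c = 0) (u v : ℕ × ℕ) :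
    P * ((P ^ u.1 * Q ^ u.2) * (P ^ v.1 * Q ^ v.2)) * Q =
      P ^ (u.1 + v.1 + 1) * Q ^ (u.2 + v.2 + 1) + (u.2 * v.1 * c) • (P ^ (u.1 + v.1) * Q ^ (u.2 + v.2)) := by
  have e1 : P * ((P ^ u.1 * Q ^ u.2) * (P ^ v.1 * Q ^ v.2)) * Q
      = P ^ u.1 * (P * (Q ^ u.2 * P ^ v.1 * Q)) * Q ^ v.2 := by
    have h1 : P * P ^ u.1 = P ^ u.1 * P := by rw [← pow_succ, pow_succ']
    have h2 : Q ^ v.2 * Q = Q * Q ^ v.2 := by rw [← pow_succ, pow_succ']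
    simp only [mul_assoc]
    rw [h2, ← mul_assoc P, h1, mul_assoc]
  rw [e1, ab3 h hc, mul_add, add_mul, mul_smul_comm, smul_mul_assoc]
  congr 1
  · rw [pow_add P _ 1, pow_add P, pow_add Q (u.2 + v.2) 1, pow_add Q u.2 v.2, pow_add Q u.2 1]
    have h1 : P * P ^ v.1 = P ^ v.1 * P := by rw [← pow_succ, pow_succ']
    have h2 : Q ^ v.2 * Q = Q * Q ^ v.2 := by rw [← pow_succ, pow_succ']
    simp only [pow_one, mul_assoc]
    rw [h2, ← mul_assoc P, h1, mul_assoc]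
  · rw [pow_add, pow_add]; simp only [mul_assoc]

theorem ab5 (h : Q * P = P * Q + c • 1) (hc : c * c = 0) (u v : ℕ × ℕ) :
    P * ((P ^ u.1 * Q ^ u.2) * (P ^ v.1 * Q ^ v.2) - (P ^ v.1 * Q ^ v.2) * (P ^ u.1 * Q ^ u.2)) * Q =
      (((u.2 : Λ) * v.1 - v.2 * u.1) * c) • (P ^ (u.1 + v.1) * Q ^ (u.2 + v.2)) := by
  rw [mul_sub, sub_mul, ab4 h hc, ab4 h hc, add_comm v.1, add_comm v.2, add_sub_add_left_eq_sub,
    ← sub_smul, sub_mul]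

theorem ab6 (h : Q * P = P * Q + c • 1) (hc : c * c = 0) (s : Finset (ℕ × ℕ)) (a b : ℕ × ℕ → Λ)
    (e1 e2 D S : A) (π : Λ) (hπ : π * π = 0) (hP : ∀ x, π • (P * x) = π • (x * P))
    (hQ : ∀ x, π • (Q * x) = π • (x * Q))
    (hD : D = ∑ u ∈ s, b u • (P ^ u.1 * Q ^ u.2) + π • e2)
    (hS : S = ∑ u ∈ s, a u • (P ^ u.1 * Q ^ u.2) + π • e1)
    (hDS : D * S = S * D + c • 1) :
    ∑ u ∈ s, ∑ v ∈ s, (b u * a v * ((((u.2 : Λ) * v.1 - v.2 * u.1)) * c)) •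
      (P ^ (u.1 + v.1) * Q ^ (u.2 + v.2)) = c • (P * Q) := by
  have hPk : ∀ k x, π • (P ^ k * x) = π • (x * P ^ k) := by
    intro k
    induction k with
    | zero => simp
    | succ k ih => intro x; rw [pow_succ', mul_assoc, hP, mul_assoc, ih, mul_assoc]
  have hQk : ∀ k x, π • (Q ^ k * x) = π • (x * Q ^ k) := by
    intro k
    induction k with
    | zero => simp
    | succ k ih => intro x; rw [pow_succ', mul_assoc, hQ, mul_assoc, ih, mul_assoc]
  have hw : ∀ u : ℕ × ℕ, ∀ x, π • (P ^ u.1 * Q ^ u.2 * x) = π • (x * (P ^ u.1 * Q ^ u.2)) := by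
    intro u x
    rw [mul_assoc, hPk, mul_assoc, hQk, mul_assoc]
  have hs : ∀ (b : ℕ × ℕ → Λ) x, π • ((∑ u ∈ s, b u • (P ^ u.1 * Q ^ u.2)) * x)
      = π • (x * ∑ u ∈ s, b u • (P ^ u.1 * Q ^ u.2)) := by
    intro b x
    rw [Finset.sum_mul, Finset.mul_sum, Finset.smul_sum, Finset.smul_sum]
    refine Finset.sum_congr rfl fun u _ => ?_
    rw [smul_mul_assoc, mul_smul_comm, smul_comm, hw, smul_comm]
  have hsb := hs b e1
  have hsa := hs a e2
  set D0 := ∑ u ∈ s, b u • (P ^ u.1 * Q ^ u.2)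
  set S0 := ∑ u ∈ s, a u • (P ^ u.1 * Q ^ u.2)
  have h1 : D0 * S0 - S0 * D0 = c • 1 := by
    have h2 : D * S - S * D = c • 1 := by rw [hDS]; abel
    rw [← h2, hD, hS]
    simp only [mul_add, add_mul, smul_mul_assoc, mul_smul_comm, smul_add, smul_smul, hπ, zero_smul]
    rw [← hsb, ← hsa]
    abel
  have h3 : P * (D0 * S0 - S0 * D0) * Q = c • (P * Q) := by
    rw [h1, mul_smul_comm, smul_mul_assoc, mul_one]
  rw [← h3]
  have h4 : D0 * S0 - S0 * D0 = ∑ u ∈ s, ∑ v ∈ s, (b u * a v) • 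
     ((P ^ u.1 * Q ^ u.2) * (P ^ v.1 * Q ^ v.2) - (P ^ v.1 * Q ^ v.2) * (P ^ u.1 * Q ^ u.2)) := by
    simp only [smul_sub, Finset.sum_sub_distrib]
    congr 1
    · rw [Finset.sum_mul_sum]
      refine Finset.sum_congr rfl fun u _ => Finset.sum_congr rfl fun v _ => ?_
      rw [smul_mul_smul_comm]
    · rw [Finset.sum_mul_sum, Finset.sum_comm]
      refine Finset.sum_congr rfl fun u _ => Finset.sum_congr rfl fun v _ => ?_
      rw [smul_mul_smul_comm, mul_comm (b u)]
  rw [h4, Finset.mul_sum, Finset.sum_mul]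
  refine Finset.sum_congr rfl fun u _ => ?_
  rw [Finset.mul_sum, Finset.sum_mul]
  refine Finset.sum_congr rfl fun v _ => ?_
  rw [mul_smul_comm, smul_mul_assoc, ab5 h hc, smul_smul]

end Abs

section Jac
variable {Λ : Type} [CommRing Λ] {p : ℕ}

theorem YXp (hp : p.Prime) (h2 : (p : Λ) * p = 0) :
    Wy Λ ^ p * Wx Λ ^ p = Wx Λ ^ p * Wy Λ ^ p + ((p.factorial : ℕ) : Λ) • 1 := by
  apply cf_inj
  rw [cf_add, rho_xy, cf_smul, cf_one, cf_mul]
  have hx : cf (Wx Λ ^ p) = X ^ p := by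
    have := rho_xy (R := Λ) p 0
    simpa [monomial_one_right_eq_X_pow] using this
  rw [hx, map_pow (rho Λ), rho_y, Yop]
  set B : Module.End Λ Λ[X][X] := (derivative : Λ[X][X] →ₗ[Λ[X]] Λ[X][X]).restrictScalars Λ
  set A' : Module.End Λ Λ[X][X] := LinearMap.mulLeft Λ (C X : Λ[X][X])
  have hcomm : Commute A' B := by
    ext1 g
    simp [A', B, Module.End.mul_apply]
  have hB : ∀ r, (B ^ r) (X ^ p) = (p.descFactorial r : Λ) • (X ^ (p - r) : Λ[X][X]) := by
    intro r
    have : ∀ g, (B ^ r) g = derivative^[r] g := by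
      intro g
      rw [Module.End.pow_apply]; rfl
    rw [this, iterate_derivative_X_pow_eq_natCast_mul]
    simp [Algebra.smul_def]
  have hA : ∀ r g, (A' ^ r) g = C (X ^ r) * g := by
    intro r g
    rw [LinearMap.pow_mulLeft, LinearMap.mulLeft_apply, C_pow]
  rw [hcomm.add_pow, LinearMap.sum_apply, Finset.sum_range_succ, ← Nat.sub_add_cancel hp.pos, Finset.sum_range_succ']
  rw [Nat.sub_add_cancel hp.pos, Finset.sum_eq_zero]
  · rw [zero_add, add_comm]
    congr 1
    · simp [hA, Module.End.mul_apply, C_mul_X_pow_eq_monomial, -map_pow]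
    · simp only [Nat.choose_zero_right, pow_zero, one_mul, Nat.sub_zero, Nat.cast_one, mul_one]
      rw [hB, Nat.descFactorial_self]; simp
  · intro m hm
    rw [Finset.mem_range] at hm
    obtain ⟨x, hx⟩ : p ∣ p.choose (m+1) := hp.dvd_choose_self (by omega) (by omega)
    obtain ⟨y, hy⟩ : p ∣ p.descFactorial (p - (m+1)) := by
      have : p - (m+1) = (p - (m+1) - 1) + 1 := by omega
      rw [this]
      obtain ⟨q, rfl⟩ : ∃ q, p = q + 1 := ⟨p - 1, by omega⟩
      rw [Nat.succ_descFactorial_succ]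
      exact dvd_mul_right _ _
    rw [← (Nat.cast_commute (p.choose (m+1)) _).eq, Module.End.mul_apply, Module.End.mul_apply, hB, hx, hy, map_smul]
    have hcast : ∀ (n : ℕ) (g : Λ[X][X]), ((n : Module.End Λ Λ[X][X])) g = (n : Λ) • g := by
      intro n g
      rw [Module.End.natCast_apply, Nat.cast_smul_eq_nsmul]
    rw [hcast, smul_smul]
    have hz : ((p * x : ℕ) : Λ) * ((p * y : ℕ) : Λ) = 0 := by
      push_cast; linear_combination ((x : Λ) * y) * h2
    rw [hz, zero_smul]

theorem Jac (hp : p.Prime) (h2 : (p : Λ) * p = 0) (S D e1 e2 : Weyl Λ) (hDS : D * S = S * D + 1)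
    (N : ℕ) (a b : ℕ × ℕ → Λ)
    (hD : D ^ p = ∑ u ∈ box N, b u • (Wx Λ ^ (p * u.1) * Wy Λ ^ (p * u.2)) + (p : Λ) • e2)
    (hS : S ^ p = ∑ u ∈ box N, a u • (Wx Λ ^ (p * u.1) * Wy Λ ^ (p * u.2)) + (p : Λ) • e1)
    (I J : ℕ) : (p.factorial : Λ) * (∑ u ∈ box N, ∑ v ∈ box N, if u.1 + v.1 = I ∧ u.2 + v.2 = J then
      b u * a v * ((u.2 : Λ) * v.1 - v.2 * u.1) else 0) = p.factorial * (if I = 1 ∧ J = 1 then 1 else 0) := by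
  obtain ⟨c', hc'⟩ : p ∣ p.factorial := Nat.dvd_factorial hp.pos le_rfl
  have hc : (p.factorial : Λ) * p.factorial = 0 := by
    rw [hc']; push_cast; linear_combination (c' : Λ) ^ 2 * h2
  have hpp : (p : Weyl Λ) * p = 0 := by
    have := congrArg (algebraMap Λ (Weyl Λ)) h2
    simpa using this
  have hQP := YXp hp h2
  have hDS' : D ^ p * S ^ p = S ^ p * D ^ p + ((p.factorial : ℕ) : Λ) • 1 := by
    have := congrArg (lift S D hDS) hQP
    simpa using this
  obtain ⟨q, hq⟩ : ∃ q, p = q + 1 := ⟨p - 1, by have := hp.pos; omega⟩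
  have hP : ∀ x, (p : Λ) • (Wx Λ ^ p * x) = (p : Λ) • (x * Wx Λ ^ p) := by
    intro x
    induction x using ind with
    | hc r => rw [Algebra.commutes]
    | hx => rw [← pow_succ, pow_succ']
    | hy =>
      have := comm_pow (rel (R := Λ)) q
      rw [← hq] at this
      rw [this, smul_add]
      symm; rw [add_eq_left, Algebra.smul_def, map_natCast, ← mul_assoc, hpp, zero_mul]
    | ha a b h1 h2 => rw [mul_add, add_mul, smul_add, smul_add, h1, h2]
    | hm a b h1 h2 => rw [← mul_assoc, ← smul_mul_assoc, h1, smul_mul_assoc, mul_assoc, ← mul_smul_comm, h2, mul_smul_comm, mul_assoc]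
  have hQ : ∀ x, (p : Λ) • (Wy Λ ^ p * x) = (p : Λ) • (x * Wy Λ ^ p) := by
    intro x
    induction x using ind with
    | hc r => rw [Algebra.commutes]
    | hy => rw [← pow_succ, pow_succ']
    | hx =>
      have := comm_pow' (rel (R := Λ)) q
      rw [← hq] at this
      rw [this, smul_add]
      rw [add_eq_left, Algebra.smul_def, map_natCast, ← mul_assoc, hpp, zero_mul]
    | ha a b h1 h2 => rw [mul_add, add_mul, smul_add, smul_add, h1, h2]
    | hm a b h1 h2 => rw [← mul_assoc, ← smul_mul_assoc, h1, smul_mul_assoc, mul_assoc, ← mul_smul_comm, h2, mul_smul_comm, mul_assoc]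
  simp only [pow_mul] at hD hS
  have key := ab6 hQP hc (box N) a b e1 e2 (D ^ p) (S ^ p) p h2 hP hQ hD hS hDS'
  have k2 := congrArg (fun z => co z (p * I, p * J)) key
  simp only [co_sum, co_smul, ← pow_mul, co_xy] at k2
  have hcan : ∀ x y : ℕ, p * x = p * y ↔ x = y := fun x y => Nat.mul_right_inj hp.ne_zero
  have hcan1 : ∀ x : ℕ, p * x = p ↔ x = 1 := fun x => by
    conv_lhs => rhs; rw [← mul_one p]
    exact hcan x 1
  simp only [Prod.mk.injEq, hcan, hcan1] at k2
  rw [← k2, Finset.mul_sum]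
  refine Finset.sum_congr rfl fun u _ => ?_
  rw [Finset.mul_sum]
  refine Finset.sum_congr rfl fun v _ => ?_
  by_cases h : u.1 + v.1 = I ∧ u.2 + v.2 = J
  · rw [if_pos h, if_pos ⟨h.1.symm, h.2.symm⟩]; ring
  · rw [if_neg h, if_neg (fun h' => h ⟨h'.1.symm, h'.2.symm⟩)]; ring

end Jac
end
end WP

namespace WP
noncomputable section

section Classical
variable {k : Type*} [Field k]

theorem extremal (N : ℕ) (a b : ℕ × ℕ → k) (ha : ∀ v, a v ≠ 0 → v ∈ box N)
    (hb : ∀ u, b u ≠ 0 → u ∈ box N) (hk : ∀ n : ℕ, 0 < n → n ≤ 2 * N → (n : k) ≠ 0)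
    (hJ : ∀ I J, (∑ u ∈ box N, ∑ v ∈ box N, if u.1 + v.1 = I ∧ u.2 + v.2 = J then
      b u * a v * ((u.2 : k) * v.1 - v.2 * u.1) else 0) = if I = 1 ∧ J = 1 then 1 else 0)
    (ha0 : a (1, 0) ≠ 0) (hb0 : b (0, 1) ≠ 0)
    (q r : ℤ) (hq : 0 ≤ q) (hr : 0 ≤ r) (hqr : 0 < q + r)
    (hA : ∀ v, a v ≠ 0 → r * (v.1 - 1) ≤ q * v.2)
    (hB : ∀ u, b u ≠ 0 → r * u.1 ≤ q * (u.2 - 1)) :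
    (∀ v, a v ≠ 0 → r * (v.1 - 1) = q * v.2 → v.1 + v.2 ≤ 1) ∧
    (∀ u, b u ≠ 0 → r * u.1 = q * (u.2 - 1) → u.1 + u.2 ≤ 1) := by
  classical
  obtain ⟨V, hV, hVm⟩ := ((box N).filter (fun v => a v ≠ 0 ∧ r * ((v.1 : ℤ) - 1) = q * v.2)).exists_max_image
    (fun v => v.1 + v.2) ⟨(1, 0), by simp [ha0, ha]⟩
  obtain ⟨U, hU, hUm⟩ := ((box N).filter (fun u => b u ≠ 0 ∧ r * (u.1 : ℤ) = q * (u.2 - 1))).exists_max_image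
    (fun u => u.1 + u.2) ⟨(0, 1), by simp [hb0, hb]⟩
  simp only [Finset.mem_filter] at hV hU hVm hUm
  have hV1 := hVm (1, 0) ⟨ha _ ha0, ha0, by simp⟩
  have hU1 := hUm (0, 1) ⟨hb _ hb0, hb0, by simp⟩
  simp only at hV1 hU1
  suffices h : V.1 + V.2 ≤ 1 ∧ U.1 + U.2 ≤ 1 by
    exact ⟨fun v h1 h2 => (hVm v ⟨ha _ h1, h1, h2⟩).trans h.1,
      fun u h1 h2 => (hUm u ⟨hb _ h1, h1, h2⟩).trans h.2⟩
  by_contra hcon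
  have hs := hJ (U.1 + V.1) (U.2 + V.2)
  rw [if_neg (by omega)] at hs
  have hz : ∀ u ∈ box N, ∀ v ∈ box N, (u ≠ U ∨ v ≠ V) →
      (if u.1 + v.1 = U.1 + V.1 ∧ u.2 + v.2 = U.2 + V.2 then
      b u * a v * ((u.2 : k) * v.1 - v.2 * u.1) else 0) = 0 := by
    intro u hu v hv hne
    split_ifs with h
    swap
    · rfl
    by_cases hbu : b u = 0
    · rw [hbu]; ring
    by_cases hav : a v = 0
    · rw [hav]; ring
    exfalso
    have e1 := hA v hav
    have e2 := hB u hbu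
    have e3 := hV.2.2
    have e4 := hU.2.2
    have f1 : (u.1 : ℤ) + v.1 = U.1 + V.1 := by exact_mod_cast h.1
    have f2 : (u.2 : ℤ) + v.2 = U.2 + V.2 := by exact_mod_cast h.2
    have g : r * (u.1 : ℤ) - q * (u.2 - 1) + (r * (v.1 - 1) - q * v.2) = 0 := by
      linear_combination r * f1 - q * f2 + e3 + e4
    have g1 : r * ((v.1 : ℤ) - 1) = q * v.2 := by linarith
    have g2 : r * (u.1 : ℤ) = q * (u.2 - 1) := by linarith
    have m1 := hVm v ⟨hv, hav, g1⟩
    have m2 := hUm u ⟨hu, hbu, g2⟩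
    have m3 : v.1 + v.2 = V.1 + V.2 := by omega
    have m4 : u.1 + u.2 = U.1 + U.2 := by omega
    have m3' : (v.1 : ℤ) + v.2 = V.1 + V.2 := by exact_mod_cast m3
    have n1 : (q + r) * ((v.1 : ℤ) - V.1) = 0 := by linear_combination q * m3' + g1 - e3
    rcases mul_eq_zero.1 n1 with h0 | h0
    · omega
    have : v = V := Prod.ext (by omega) (by omega)
    have : u = U := Prod.ext (by omega) (by omega)
    tauto
  rw [Finset.sum_eq_single U, Finset.sum_eq_single V, if_pos ⟨rfl, rfl⟩] at hs
  rotate_left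
  · intro v hv hne; exact hz U hU.1 v hv (Or.inr hne)
  · intro h; exact absurd hV.1 h
  · intro u hu hne; exact Finset.sum_eq_zero fun v hv => hz u hu v hv (Or.inl hne)
  · intro h; exact absurd hU.1 h
  have e3 := hV.2.2
  have e4 := hU.2.2
  have V1 : 1 ≤ V.1 := by
    rcases hr.lt_or_eq with h | h
    · by_contra hc
      have : (V.1 : ℤ) = 0 := by omega
      rw [this] at e3
      have : 0 ≤ q * V.2 := by positivity
      linarith
    · subst h
      have hq' : q ≠ 0 := by omega
      have : (V.2 : ℤ) = 0 := by
        rcases mul_eq_zero.1 (show q * (V.2 : ℤ) = 0 by linarith) with h | h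
        · exact absurd h hq'
        · exact h
      omega
  have U2 : 1 ≤ U.2 := by
    rcases hq.lt_or_eq with h | h
    · by_contra hc
      have : (U.2 : ℤ) = 0 := by omega
      rw [this] at e4
      have : 0 ≤ r * U.1 := by positivity
      linarith
    · subst h
      have hq' : r ≠ 0 := by omega
      have : (U.1 : ℤ) = 0 := by
        rcases mul_eq_zero.1 (show r * (U.1 : ℤ) = 0 by linarith) with h | h
        · exact absurd h hq'
        · exact h
      omega
  have par : (q + r) * (((V.1 : ℤ) - 1) * (U.2 - 1) - U.1 * V.2) = 0 := by
    linear_combination (U.2 - 1 : ℤ) * e3 - (V.2 : ℤ) * e4 - (V.1 - 1 : ℤ) * e4 + (U.1 : ℤ) * e3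
  have par2 : ((V.1 : ℤ) - 1) * (U.2 - 1) - U.1 * V.2 = 0 := by
    rcases mul_eq_zero.1 par with h | h
    · omega
    · exact h
  have fin : ((U.2 : ℤ) * V.1 - V.2 * U.1) = ((V.1 + U.2 - 1 : ℕ) : ℤ) := by
    rw [Nat.cast_sub (by omega)]; push_cast; linarith
  have fin2 : ((U.2 : k) * V.1 - V.2 * U.1) = ((V.1 + U.2 - 1 : ℕ) : k) := by
    exact_mod_cast congrArg (Int.cast : ℤ → k) fin
  rw [fin2] at hs
  have hbx := mem_box.1 hV.1
  have hbx2 := mem_box.1 hU.1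
  exact mul_ne_zero (mul_ne_zero hU.2.1 hV.2.1) (hk _ (by omega) (by omega)) hs

theorem classical (N : ℕ) (a b : ℕ × ℕ → k) (ha : ∀ v, a v ≠ 0 → v ∈ box N)
    (hb : ∀ u, b u ≠ 0 → u ∈ box N) (hk : ∀ n : ℕ, 0 < n → n ≤ 2 * N → (n : k) ≠ 0)
    (hae : ∀ v, a v ≠ 0 → Even v.2) (hbo : ∀ v, b v ≠ 0 → Odd v.2)
    (hJ : ∀ I J, (∑ u ∈ box N, ∑ v ∈ box N, if u.1 + v.1 = I ∧ u.2 + v.2 = J then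
      b u * a v * ((u.2 : k) * v.1 - v.2 * u.1) else 0) = if I = 1 ∧ J = 1 then 1 else 0)
    (u : ℕ × ℕ) (hu : b u ≠ 0) : u = (0, 1) := by
  classical
  have h0 : b (0, 1) ≠ 0 ∧ a (1, 0) ≠ 0 := by
    by_contra hc
    have h1 := hJ 1 1
    rw [if_pos ⟨rfl, rfl⟩, Finset.sum_eq_zero] at h1
    · exact zero_ne_one h1
    intro u _
    apply Finset.sum_eq_zero
    intro v _
    split_ifs with h
    swap
    · rfl
    by_cases hbu : b u = 0
    · rw [hbu]; ring
    by_cases hav : a v = 0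
    · rw [hav]; ring
    have := (hbo u hbu).pos
    obtain ⟨u1, u2⟩ := u
    obtain ⟨v1, v2⟩ := v
    simp only at this h
    obtain rfl : u2 = 1 := by omega
    obtain rfl : v2 = 0 := by omega
    by_cases hu1 : u1 = 0
    · subst hu1
      obtain rfl : v1 = 1 := by omega
      exact absurd ⟨hbu, hav⟩ hc
    · obtain rfl : v1 = 0 := by omega
      simp
  obtain ⟨hb0, ha0⟩ := h0
  have hE := extremal N a b ha hb hk hJ ha0 hb0
  have hbpos : ∀ u, b u ≠ 0 → 1 ≤ u.2 := fun u h => (hbo u h).pos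
  have s1 := hE 1 0 (by norm_num) (by norm_num) (by norm_num) (fun v _ => by simp)
    (fun u h => by have := hbpos u h; simp; omega)
  have sa : ∀ v, a v ≠ 0 → v.2 = 0 → v.1 ≤ 1 := fun v h h' => by
    have := s1.1 v h (by simp [h']); omega
  have sb : ∀ v, b v ≠ 0 → v.2 = 1 → v.1 = 0 := fun v h h' => by
    have := s1.2 v h (by simp [h']); omega
  by_cases hu2 : u.2 = 1
  · exact Prod.ext (sb u hu hu2) hu2
  exfalso
  let WA : Finset (ℤ × ℤ) := ((box N).filter (fun v => a v ≠ 0 ∧ 1 ≤ v.2)).image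
    (fun v => ((v.1 : ℤ) - 1, (v.2 : ℤ)))
  let WB : Finset (ℤ × ℤ) := ((box N).filter (fun v => b v ≠ 0 ∧ 2 ≤ v.2)).image
    (fun v => ((v.1 : ℤ), (v.2 : ℤ) - 1))
  have memA : ∀ v, a v ≠ 0 → 1 ≤ v.2 → ((v.1 : ℤ) - 1, (v.2 : ℤ)) ∈ WA ∪ WB := by
    intro v h1 h2
    exact Finset.mem_union_left _ (Finset.mem_image.2 ⟨v, Finset.mem_filter.2 ⟨ha v h1, h1, h2⟩, rfl⟩)
  have memB : ∀ v, b v ≠ 0 → 2 ≤ v.2 → ((v.1 : ℤ), (v.2 : ℤ) - 1) ∈ WA ∪ WB := by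
    intro v h1 h2
    exact Finset.mem_union_right _ (Finset.mem_image.2 ⟨v, Finset.mem_filter.2 ⟨hb v h1, h1, h2⟩, rfl⟩)
  have hu3 : 2 ≤ u.2 := by have := hbpos u hu; omega
  obtain ⟨w, hw, hwm⟩ := (WA ∪ WB).exists_max_image (fun w => (w.1 : ℚ) / w.2) ⟨_, memB u hu hu3⟩
  have hpos : ∀ w ∈ WA ∪ WB, 0 < w.2 := by
    intro w hw
    rcases Finset.mem_union.1 hw with h | h
    · obtain ⟨v, hv, rfl⟩ := Finset.mem_image.1 h
      have := (Finset.mem_filter.1 hv).2.2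
      simp only; omega
    · obtain ⟨v, hv, rfl⟩ := Finset.mem_image.1 h
      have := (Finset.mem_filter.1 hv).2.2
      simp only; omega
  have hmax : ∀ z ∈ WA ∪ WB, w.2 * z.1 ≤ w.1 * z.2 := by
    intro z hz
    have h1 := hwm z hz
    have p1 : (0 : ℚ) < z.2 := by exact_mod_cast hpos z hz
    have p2 : (0 : ℚ) < w.2 := by exact_mod_cast hpos w hw
    rw [div_le_div_iff₀ p1 p2] at h1
    have : z.1 * w.2 ≤ w.1 * z.2 := by exact_mod_cast h1
    linarith
  have hw2 := hpos w hw
  have hw1 : 0 ≤ w.1 := by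
    have h1 := hmax _ (memB u hu hu3)
    simp only at h1
    have h2 : 0 ≤ w.2 * (u.1 : ℤ) := by positivity
    have h3 : (0 : ℤ) < (u.2 : ℤ) - 1 := by omega
    exact nonneg_of_mul_nonneg_left (h2.trans h1) h3
  have s2 := hE w.1 w.2 hw1 hw2.le (by omega)
    (fun v h => by
      by_cases hv : v.2 = 0
      · have := sa v h hv
        rw [hv]
        have h4 : (v.1 : ℤ) - 1 ≤ 0 := by omega
        have := mul_nonpos_of_nonneg_of_nonpos hw2.le h4
        simpa using this
      · exact hmax _ (memA v h (by omega)))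
    (fun v h => by
      by_cases hv : v.2 = 1
      · rw [sb v h hv, hv]; simp
      · have := hbpos v h
        exact hmax _ (memB v h (by omega)))
  rcases Finset.mem_union.1 hw with h | h
  · obtain ⟨v, hv, rfl⟩ := Finset.mem_image.1 h
    have h5 := (Finset.mem_filter.1 hv).2
    have := s2.1 v h5.1 (by simp only; ring)
    simp only at hw1
    omega
  · obtain ⟨v, hv, rfl⟩ := Finset.mem_image.1 h
    have h5 := (Finset.mem_filter.1 hv).2
    have := s2.2 v h5.1 (by simp only; ring)
    omega

end Classical
end
end WP

namespace WP
noncomputable section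
open MulOpposite

section
variable {R : Type} [CommRing R]

theorem neg_rel {A : Type*} [Ring A] {s d : A} (h : d * s = s * d + 1) :
    s * (-d) = (-d) * s + 1 := by
  rw [mul_neg, neg_mul, h]; abel

theorem neg_rel_op {A : Type*} [Ring A] {s d : A} (h : d * s = s * d + 1) :
    op (-d) * op s = op s * op (-d) + 1 := by
  rw [← op_mul, ← op_mul, neg_rel h]; simp

def betH (R : Type) [CommRing R] : Weyl R →ₐ[R] (Weyl R)ᵐᵒᵖ :=
  lift (op (Wx R)) (op (-Wy R)) (neg_rel_op rel)

def bet (R : Type) [CommRing R] : Weyl R →ₗ[R] Weyl R :=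
  (MulOpposite.opLinearEquiv R).symm.toLinearMap ∘ₗ (betH R).toLinearMap

theorem bet_eq (a : Weyl R) : bet R a = unop (betH R a) := rfl

theorem bet_x : bet R (Wx R) = Wx R := by simp [bet_eq, betH]
theorem bet_y : bet R (Wy R) = -Wy R := by simp [bet_eq, betH]
theorem bet_one : bet R 1 = 1 := by rw [bet_eq, map_one]; rfl
theorem bet_mul (a b : Weyl R) : bet R (a * b) = bet R b * bet R a := by
  rw [bet_eq, map_mul, unop_mul]; rfl
theorem bet_pow (a : Weyl R) (n : ℕ) : bet R (a ^ n) = bet R a ^ n := by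
  rw [bet_eq, map_pow, unop_pow]; rfl

theorem bet_map {R' : Type} [CommRing R'] [Algebra R R'] (a : Weyl R) :
    bet R' (mapW R R' a) = mapW R R' (bet R a) := by
  induction a using ind with
  | hc r =>
    rw [Algebra.algebraMap_eq_smul_one, map_smul (bet R), map_smul (mapW R R'), map_smul (mapW R R'),
      bet_one, map_one, algebra_compatible_smul R' r, map_smul (bet R'), bet_one]
  | hx => rw [mapW_x, bet_x, bet_x, mapW_x]
  | hy => rw [mapW_y, bet_y, bet_y, map_neg, mapW_y]
  | ha a b h1 h2 => simp only [map_add, h1, h2]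
  | hm a b h1 h2 => simp only [map_mul, bet_mul, h1, h2]

theorem repr_box (a : Weyl R) (N : ℕ) (h : ∀ u, co a u ≠ 0 → u ∈ box N) :
    a = ∑ u ∈ box N, co a u • (Wx R ^ u.1 * Wy R ^ u.2) := by
  apply co_ext
  intro v
  rw [co_sum]
  simp only [co_smul, co_xy]
  by_cases hv : co a v = 0
  · rw [hv, eq_comm]
    apply Finset.sum_eq_zero
    intro u _
    split_ifs with h1
    · obtain ⟨rfl⟩ := h1; simp [hv]
    · simp
  · rw [Finset.sum_eq_single v]
    · simp
    · intro u _ hu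
      rw [if_neg (fun h => hu (by rw [h])), mul_zero]
    · intro h1; exact absurd (h v hv) h1

/-- coefficients of the p-th power -/
def pc (p : ℕ) (a : Weyl R) (u : ℕ × ℕ) : R := co (a ^ p) (p * u.1, p * u.2)

theorem pc_map {R' : Type} [CommRing R'] [Algebra R R'] (p : ℕ) (a : Weyl R) (u) :
    pc p (mapW R R' a) u = algebraMap R R' (pc p a u) := by
  rw [pc, pc, ← map_pow, co_map]

theorem pc_supp {p : ℕ} (hp : p.Prime) {a : Weyl R} {N : ℕ} (ha : Bd N a) (u) (h : pc p a u ≠ 0) :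
    u ∈ box N := by
  have := (ha.pow p).co h
  rw [mem_box]
  exact ⟨Nat.le_of_mul_le_mul_left this.1 hp.pos, Nat.le_of_mul_le_mul_left this.2 hp.pos⟩

theorem co_psum {p : ℕ} (hp : p.Prime) (N : ℕ) (c : ℕ × ℕ → R) (hc : ∀ u, c u ≠ 0 → u ∈ box N) (v) :
    co (∑ u ∈ box N, c u • (Wx R ^ (p * u.1) * Wy R ^ (p * u.2))) v
      = if p ∣ v.1 ∧ p ∣ v.2 then c (v.1 / p, v.2 / p) else 0 := by
  rw [co_sum]
  simp only [co_smul, co_xy]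
  obtain ⟨x, y⟩ := v
  split_ifs with h
  · obtain ⟨⟨i, rfl⟩, ⟨j, rfl⟩⟩ := h
    simp only [Nat.mul_div_cancel_left _ hp.pos]
    rw [Finset.sum_eq_single (i, j)]
    · simp
    · rintro ⟨i', j'⟩ _ hu
      rw [if_neg, mul_zero]
      intro h
      simp only [Prod.mk.injEq] at h
      have h1 := Nat.eq_of_mul_eq_mul_left hp.pos h.1
      have h2 := Nat.eq_of_mul_eq_mul_left hp.pos h.2
      exact hu (by rw [h1, h2])
    · intro h1
      by_contra h2
      apply h1
      apply hc
      intro h3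
      apply h2
      rw [h3, zero_mul]
  · apply Finset.sum_eq_zero
    rintro ⟨i', j'⟩ _
    rw [if_neg, mul_zero]
    intro h1
    simp only [Prod.mk.injEq] at h1
    exact h ⟨⟨_, h1.1⟩, ⟨_, h1.2⟩⟩

theorem co_pow_dvd {p : ℕ} (hp : p.Prime) (a b : Weyl R) (h : a * b = b * a + 1) (u : ℕ × ℕ)
    (hu : ¬(p ∣ u.1 ∧ p ∣ u.2)) : (p : R) ∣ co (a ^ p) u := by
  rw [← Ideal.mem_span_singleton, ← Ideal.Quotient.eq_zero_iff_mem]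
  set I := Ideal.span {(p : R)}
  have h0 : ((p : ℕ) : R ⧸ I) = 0 := by
    have : Ideal.Quotient.mk I (p : R) = 0 := by
      rw [Ideal.Quotient.eq_zero_iff_mem]; exact Ideal.mem_span_singleton_self _
    simpa using this
  have h1 : mapW R (R ⧸ I) a * mapW R (R ⧸ I) b = mapW R (R ⧸ I) b * mapW R (R ⧸ I) a + 1 := by
    rw [← map_mul, h, map_add, map_mul, map_one]
  have h2 := central_co hp h0 _ (central hp h0 _ _ h1) u hu
  rw [← map_pow, co_map] at h2
  exact h2

theorem pow_struct {p : ℕ} (hp : p.Prime) (a b : Weyl R) (h : a * b = b * a + 1) {N : ℕ}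
    (ha : Bd N a) : ∃ e : Weyl R,
    a ^ p = ∑ u ∈ box N, pc p a u • (Wx R ^ (p * u.1) * Wy R ^ (p * u.2)) + (p : R) • e := by
  have h1 : ∀ u : ℕ × ℕ, ∃ c : R, co (a ^ p) u =
      (if p ∣ u.1 ∧ p ∣ u.2 then co (a ^ p) u else 0) + p * c ∧ (c ≠ 0 → u ∈ box (p * N)) := by
    intro u
    by_cases hz : co (a ^ p) u = 0
    · exact ⟨0, by simp [hz], by simp⟩
    · have hm : u ∈ box (p * N) := mem_box.2 ((ha.pow p).co hz)
      split_ifs with hu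
      · exact ⟨0, by simp, by simp⟩
      · obtain ⟨c, hc⟩ := co_pow_dvd hp a b h u hu
        exact ⟨c, by simp [hc], fun _ => hm⟩
  choose c hc hc' using h1
  refine ⟨∑ u ∈ box (p * N), c u • (Wx R ^ u.1 * Wy R ^ u.2), ?_⟩
  apply co_ext
  intro v
  rw [co_add, co_smul, co_psum hp N _ (pc_supp hp ha), co_sum]
  simp only [co_smul, co_xy]
  have : ∑ u ∈ box (p * N), c u * (if v = (u.1, u.2) then (1 : R) else 0) = c v := by
    rw [Finset.sum_eq_single v]
    · simp
    · intro u _ hu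
      rw [if_neg (fun h => hu (by rw [h])), mul_zero]
    · intro h1
      by_contra h2
      apply h1
      apply hc'
      intro h3
      apply h2
      rw [h3, zero_mul]
  rw [this, hc v]
  congr 1
  split_ifs with hv
  · obtain ⟨x, y⟩ := v
    simp only [pc]
    rw [Nat.mul_div_cancel' hv.1, Nat.mul_div_cancel' hv.2]
  · rfl

theorem bet_psum {p : ℕ} (hp : p.Prime) (hodd : Odd p) (hR : (p : R) = 0) (i j : ℕ) :
    bet R (Wx R ^ (p * i) * Wy R ^ (p * j)) = ((-1 : R) ^ j) • (Wx R ^ (p * i) * Wy R ^ (p * j)) := by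
  have hy : (- Wy R) ^ (p * j) = ((-1 : R) ^ j) • Wy R ^ (p * j) := by
    have : - Wy R = (-1 : R) • Wy R := by
      apply co_ext; intro u; rw [co_neg, co_smul]; ring
    rw [this, smul_pow, pow_mul, hodd.neg_one_pow]
  have hx : ∀ x, Wx R ^ p * x = x * Wx R ^ p := central hp hR _ _ (neg_rel rel)
  have hxi : Commute (Wx R ^ (p * i)) (Wy R ^ (p * j)) := by
    rw [pow_mul]
    exact Commute.pow_left (hx _) _
  rw [bet_mul, bet_pow, bet_pow, bet_x, bet_y, hy, smul_mul_assoc, hxi.eq]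

theorem pc_bet {p : ℕ} (hp : p.Prime) (hodd : Odd p) (hR : (p : R) = 0) (a b : Weyl R)
    (h : a * b = b * a + 1) {N : ℕ} (ha : Bd N a) (e : R) (hb : bet R a = e • a) (u) :
    (-1) ^ u.2 * pc p a u = e ^ p * pc p a u := by
  obtain ⟨e1, he1⟩ := pow_struct hp a b h ha
  rw [hR, zero_smul, add_zero] at he1
  have h2 : bet R (a ^ p) = ∑ u ∈ box N, ((-1) ^ u.2 * pc p a u) •
      (Wx R ^ (p * u.1) * Wy R ^ (p * u.2)) := by
    rw [he1, map_sum]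
    apply Finset.sum_congr rfl
    intro u _
    rw [map_smul, bet_psum hp hodd hR, smul_smul, mul_comm]
  have h3 : co (bet R (a ^ p)) (p * u.1, p * u.2) = (-1) ^ u.2 * pc p a u := by
    rw [h2, co_psum hp N]
    · simp [Nat.mul_div_cancel_left _ hp.pos]
    · intro u hu
      exact pc_supp hp ha u (right_ne_zero_of_mul hu)
  rw [← h3, bet_pow, hb, smul_pow, co_smul, pc]

end

theorem core {R k : Type} [CommRing R] [IsDomain R] [Field k] [Algebra R k] {p : ℕ} (hp : p.Prime)
    (hpR : (p : R) ≠ 0) (hpk : (p : k) = 0) (S D : Weyl R) (hDS : D * S = S * D + 1)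
    (hbS : bet R S = S) (hbD : bet R D = (-1 : R) • D) (N : ℕ) (hS : Bd N S) (hD : Bd N D)
    (hN : 2 * N < p) (hp2 : 2 < p) (n m : ℕ) (h0 : algebraMap R k (co D (n, m)) ≠ 0)
    (htop : ∀ u, co D u ≠ 0 → u.1 < n ∨ (u.1 = n ∧ u.2 ≤ m)) : (n, m) = (0, 1) := by
  have hodd : Odd p := hp.odd_of_ne_two (by omega)
  have : CharP k p := by
    have := CharP.exists k
    obtain ⟨q, hq⟩ := this
    have h1 : q ∣ p := (CharP.cast_eq_zero_iff k q p).1 hpk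
    rcases (Nat.dvd_prime hp).1 h1 with rfl | rfl
    · exact absurd rfl (CharP.char_ne_one k 1)
    · exact hq
  have hk : ∀ n, 0 < n → n < p → (n : k) ≠ 0 := by
    intro n h1 h2 h3
    have := Nat.le_of_dvd h1 ((CharP.cast_eq_zero_iff k p n).1 h3)
    omega
  have h2k : (2 : k) ≠ 0 := by
    have := hk 2 (by norm_num) hp2
    exact_mod_cast this
  let ψ := mapW R k
  have hSD := neg_rel hDS
  have hB : ∀ {a : Weyl R}, Bd N a → Bd N (mapW R k a) := by
    intro a ha
    apply Bd_of_co
    intro u hu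
    rw [co_map] at hu
    exact ha.co (fun h => hu (by rw [h, map_zero]))
  have hDS' : mapW R k D * mapW R k S = mapW R k S * mapW R k D + 1 := by
    rw [← map_mul, hDS, map_add, map_mul, map_one]
  have hbS' : bet k (mapW R k S) = (1 : k) • mapW R k S := by
    rw [bet_map, hbS, one_smul]
  have hbD' : bet k (mapW R k D) = (-1 : k) • mapW R k D := by
    rw [bet_map, hbD, map_smul, algebra_compatible_smul k, map_neg, map_one]
  have pS := pc_bet hp hodd hpk _ _ (neg_rel hDS') (hB hS) 1 hbS'
  have pD := pc_bet hp hodd hpk _ _ hDS' (hB hD) (-1) hbD'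
  apply classical N (pc p (mapW R k S)) (pc p (mapW R k D)) (pc_supp hp (hB hS))
    (pc_supp hp (hB hD)) (fun n h1 h2 => hk n h1 (by omega))
  · intro v hv
    by_contra hc
    rw [Nat.not_even_iff_odd] at hc
    have := pS v
    rw [hc.neg_one_pow, one_pow, one_mul] at this
    apply hv
    have h3 : 2 * pc p (mapW R k S) v = 0 := by linear_combination -this
    exact (mul_eq_zero.1 h3).resolve_left h2k
  · intro v hv
    by_contra hc
    rw [Nat.not_odd_iff_even] at hc
    have := pD v
    rw [hc.neg_one_pow, hodd.neg_one_pow] at this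
    apply hv
    have h3 : 2 * pc p (mapW R k D) v = 0 := by linear_combination this
    exact (mul_eq_zero.1 h3).resolve_left h2k
  · intro I J
    obtain ⟨e2, he2⟩ := pow_struct hp D S hDS hD
    obtain ⟨e1, he1⟩ := pow_struct hp S (-D) hSD hS
    set Id := Ideal.span {(p : R) * p} with hId
    let Q := R ⧸ Id
    have hQ : ((p : ℕ) : Q) * p = 0 := by
      have : Ideal.Quotient.mk Id ((p : R) * p) = 0 := by
        rw [Ideal.Quotient.eq_zero_iff_mem]; exact Ideal.mem_span_singleton_self _
      simpa using this
    have hm : ∀ (c : ℕ × ℕ → R) (e : Weyl R), mapW R Q (∑ u ∈ box N, c u • (Wx R ^ (p * u.1) *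
        Wy R ^ (p * u.2)) + (p : R) • e) = ∑ u ∈ box N, algebraMap R Q (c u) • (Wx Q ^ (p * u.1) *
        Wy Q ^ (p * u.2)) + (p : Q) • mapW R Q e := by
      intro c e
      rw [map_add, map_sum, map_smul, algebra_compatible_smul Q (p : R), map_natCast]
      congr 1
      apply Finset.sum_congr rfl
      intro u _
      rw [map_smul, map_mul, map_pow, map_pow, mapW_x, mapW_y, algebra_compatible_smul Q (c u)]
    have hDS2 : mapW R Q D * mapW R Q S = mapW R Q S * mapW R Q D + 1 := by
      rw [← map_mul, hDS, map_add, map_mul, map_one]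
    have hJ := Jac hp hQ (mapW R Q S) (mapW R Q D) (mapW R Q e1) (mapW R Q e2) hDS2 N
      (fun u => algebraMap R Q (pc p S u)) (fun u => algebraMap R Q (pc p D u))
      (by rw [← map_pow, ← hm, ← he2]) (by rw [← map_pow, ← hm, ← he1]) I J
    set Z : R := ∑ u ∈ box N, ∑ v ∈ box N, (if u.1 + v.1 = I ∧ u.2 + v.2 = J then
      pc p D u * pc p S v * ((u.2 : R) * v.1 - v.2 * u.1) else 0) with hZ
    have hZm : ∀ (T : Type) [CommRing T] [Algebra R T], algebraMap R T Z =
        ∑ u ∈ box N, ∑ v ∈ box N, (if u.1 + v.1 = I ∧ u.2 + v.2 = J then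
      algebraMap R T (pc p D u) * algebraMap R T (pc p S v) * ((u.2 : T) * v.1 - v.2 * u.1) else 0) := by
      intro T _ _
      rw [hZ, map_sum]
      refine Finset.sum_congr rfl fun u _ => ?_
      rw [map_sum]
      refine Finset.sum_congr rfl fun v _ => ?_
      split_ifs <;> simp
    rw [← hZm Q] at hJ
    have hJ2 : algebraMap R Q (p.factorial * (Z - if I = 1 ∧ J = 1 then 1 else 0)) = 0 := by
      rw [map_mul, map_sub, mul_sub, map_natCast, hJ]
      split_ifs <;> simp
    have hJ3 : (p : R) * p ∣ p.factorial * (Z - if I = 1 ∧ J = 1 then 1 else 0) := by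
      rw [← Ideal.mem_span_singleton, ← Ideal.Quotient.eq_zero_iff_mem]
      exact hJ2
    obtain ⟨r, hr⟩ := hJ3
    obtain ⟨q, rfl⟩ : ∃ q, p = q + 1 := ⟨p - 1, by omega⟩
    have hr2 : (q.factorial : R) * (Z - if I = 1 ∧ J = 1 then 1 else 0) = ((q + 1 : ℕ) : R) * r := by
      apply mul_left_cancel₀ hpR
      rw [Nat.factorial_succ, Nat.cast_mul] at hr
      linear_combination hr
    have hr3 := congrArg (algebraMap R k) hr2
    rw [map_mul, map_mul, map_natCast, map_natCast, hpk, zero_mul] at hr3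
    have hq : (q.factorial : k) ≠ 0 := by
      rw [Ne, CharP.cast_eq_zero_iff k (q + 1), hp.dvd_factorial]
      omega
    have hr4 := (mul_eq_zero.1 hr3).resolve_left hq
    rw [map_sub, sub_eq_zero, hZm k] at hr4
    simp only [pc_map]
    rw [hr4]
    split_ifs <;> simp
  · rw [pc_map, pc, co_top_pow D n m htop, map_pow]
    exact pow_ne_zero _ h0

end
end WP

namespace WP
noncomputable section

theorem jacobson_int : IsJacobsonRing ℤ := by
  rw [isJacobsonRing_iff_prime_eq]
  intro I hI
  by_cases h : I = ⊥
  · subst h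
    rw [eq_bot_iff]
    intro x hx
    rw [Ideal.mem_bot]
    by_contra hx0
    obtain ⟨p, hp1, hp⟩ := Nat.exists_infinite_primes (x.natAbs + 1)
    have hpi : Prime (p : ℤ) := Nat.prime_iff_prime_int.1 hp
    have hm : (Ideal.span {(p : ℤ)}).IsMaximal :=
      PrincipalIdealRing.isMaximal_of_irreducible hpi.irreducible
    have : x ∈ Ideal.span {(p : ℤ)} := Ideal.mem_sInf.1 hx ⟨bot_le, hm⟩
    rw [Ideal.mem_span_singleton] at this
    have h2 := Int.natAbs_dvd_natAbs.2 this
    have h3 := Nat.le_of_dvd (Int.natAbs_pos.2 hx0) h2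
    simp at h3
    omega
  · have := IsPrime.to_maximal_ideal (S := I) h
    exact Ideal.jacobson_eq_self_of_isMaximal

theorem exists_red {K : Type} [Field K] [CharZero K] (T : Set K) (hT : T.Finite)
    (hT0 : ∀ x ∈ T, x ≠ 0) (M : ℕ) : ∃ (A : Subalgebra ℤ K) (_ : T ⊆ A) (k : Type) (_ : Field k)
      (φ : A →+* k) (p : ℕ), p.Prime ∧ M < p ∧ (p : k) = 0 ∧ ∀ x (hx : x ∈ A), x ∈ T → φ ⟨x, hx⟩ ≠ 0 := by
  let T' : Set K := T ∪ (fun x => x⁻¹) '' T ∪ {((M.factorial : ℕ) : K)⁻¹}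
  have hT' : T'.Finite := (hT.union (hT.image _)).union (Set.finite_singleton _)
  let A := Algebra.adjoin ℤ T'
  have hft : Algebra.FiniteType ℤ A := by
    rw [← Subalgebra.fg_iff_finiteType]
    exact ⟨hT'.toFinset, by simp [A]⟩
  obtain ⟨m, hm⟩ := Ideal.exists_maximal A
  let : Field (A ⧸ m) := Ideal.Quotient.field m
  have hsub : T' ⊆ A := Algebra.subset_adjoin
  have := jacobson_int
  have hft2 : Algebra.FiniteType ℤ (A ⧸ m) :=
    Algebra.FiniteType.of_surjective (Ideal.Quotient.mkₐ ℤ m) (Ideal.Quotient.mkₐ_surjective ℤ m)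
  have hfin : Module.Finite ℤ (A ⧸ m) := finite_of_finite_type_of_isJacobsonRing ℤ (A ⧸ m)
  have hnz : ¬ CharZero (A ⧸ m) := by
    intro hz
    have hinj : Function.Injective (algebraMap ℤ (A ⧸ m)) :=
      RingHom.injective_int _
    have := isField_of_isIntegral_of_isField hinj (Field.toIsField (A ⧸ m))
    exact Int.not_isField this
  obtain ⟨p, hp⟩ := CharP.exists (A ⧸ m)
  have hp0 : p ≠ 0 := by
    rintro rfl
    exact hnz (CharP.charP_to_charZero (A ⧸ m))
  have hpp : p.Prime := (CharP.char_is_prime_or_zero (A ⧸ m) p).resolve_right hp0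
  have hunit : ∀ x y (hx : x ∈ A) (hy : y ∈ A), x * y = 1 →
      Ideal.Quotient.mk m ⟨x, hx⟩ ≠ 0 := by
    intro x y hx hy hxy h0
    have h1 : (⟨x, hx⟩ : A) * ⟨y, hy⟩ = 1 := Subtype.ext hxy
    have h2 := congrArg (Ideal.Quotient.mk m) h1
    rw [map_mul, h0, zero_mul, map_one] at h2
    exact zero_ne_one h2
  refine ⟨A, fun x hx => hsub (Or.inl (Or.inl hx)), A ⧸ m, inferInstance, Ideal.Quotient.mk m, p, hpp,
    ?_, CharP.cast_eq_zero _ _, ?_⟩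
  · by_contra hle
    push Not at hle
    have h1 : ((M.factorial : ℕ) : A ⧸ m) = 0 := by
      rw [CharP.cast_eq_zero_iff (A ⧸ m) p]
      exact hpp.dvd_factorial.2 hle
    refine hunit (M.factorial : K) ((M.factorial : K)⁻¹) (natCast_mem A _) (hsub (Or.inr rfl))
      (mul_inv_cancel₀ (by exact_mod_cast M.factorial_ne_zero)) ?_
    rw [← h1]
    rfl
  · intro x hx hxT
    exact hunit x x⁻¹ hx (hsub (Or.inl (Or.inr ⟨x, hxT, rfl⟩))) (mul_inv_cancel₀ (hT0 x hxT))

theorem exists_lift {K : Type} [Field K] (A : Subalgebra ℤ K) (a : Weyl K) (N : ℕ) (ha : Bd N a)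
    (h : ∀ u, co a u ≠ 0 → co a u ∈ A) : ∃ b : Weyl A, mapW A K b = a := by
  have h' : ∀ u, co a u ∈ A := by
    intro u
    by_cases hu : co a u = 0
    · rw [hu]; exact zero_mem A
    · exact h u hu
  refine ⟨∑ u ∈ box N, (⟨co a u, h' u⟩ : A) • (Wx A ^ u.1 * Wy A ^ u.2), ?_⟩
  refine Eq.trans ?_ (repr_box a N (fun u hu => mem_box.2 (ha.co hu))).symm
  rw [map_sum]
  apply Finset.sum_congr rfl
  intro u hu
  rw [map_smul, map_mul, map_pow, map_pow, mapW_x, mapW_y, algebra_compatible_smul K]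
  rfl

theorem nontriv (K : Type) [Field K] : (1 : Weyl K) ≠ 0 := by
  intro h
  have h1 := co_xy (R := K) 0 0 (0, 0)
  rw [pow_zero, pow_zero, one_mul, h, co_zero] at h1
  simp at h1

theorem symm_D {K : Type} [Field K] [CharZero K] (S D : Weyl K) (hDS : D * S = S * D + 1)
    (hbS : bet K S = S) (hbD : bet K D = (-1 : K) • D) : ∃ c : K, D = c • Wy K := by
  obtain ⟨N1, hN1⟩ := exists_Bd S
  obtain ⟨N2, hN2⟩ := exists_Bd D
  set N := max N1 N2
  have hS : Bd N S := hN1.mono (le_max_left _ _)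
  have hD : Bd N D := hN2.mono (le_max_right _ _)
  have hD0 : D ≠ 0 := by
    intro h
    rw [h, zero_mul, mul_zero, zero_add] at hDS
    exact nontriv K hDS.symm
  obtain ⟨n, m, hnm, htop⟩ := exists_top D hD0
  let T : Set K := {x | x ≠ 0 ∧ ((∃ u ∈ box N, co S u = x) ∨ ∃ u ∈ box N, co D u = x)}
  have hT : T.Finite := by
    apply Set.Finite.subset (((box N).finite_toSet.image (co S)).union
      ((box N).finite_toSet.image (co D)))
    rintro x ⟨_, h | h⟩
    · exact Or.inl h
    · exact Or.inr h
  obtain ⟨A, hTA, k, hk, φ, p, hp, hMp, hpk, hφ⟩ := exists_red T hT (fun x hx => hx.1) (2 * N + 2)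
  have mS : ∀ u, co S u ≠ 0 → co S u ∈ T := fun u hu => ⟨hu, Or.inl ⟨u, mem_box.2 (hS.co hu), rfl⟩⟩
  have mD : ∀ u, co D u ≠ 0 → co D u ∈ T := fun u hu => ⟨hu, Or.inr ⟨u, mem_box.2 (hD.co hu), rfl⟩⟩
  obtain ⟨S', hS'⟩ := exists_lift A S N hS (fun u hu => hTA (mS u hu))
  obtain ⟨D', hD'⟩ := exists_lift A D N hD (fun u hu => hTA (mD u hu))
  have hAinj : Function.Injective (algebraMap A K) := Subtype.val_injective
  have hinj := mapW_inj hAinj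
  let := φ.toAlgebra
  have coS : ∀ u, co S u = algebraMap A K (co S' u) := by intro u; rw [← hS', co_map]
  have coD : ∀ u, co D u = algebraMap A K (co D' u) := by intro u; rw [← hD', co_map]
  have hco : ∀ u, co D' u ≠ 0 → co D u ≠ 0 := by
    intro u h1 h2
    rw [coD] at h2
    exact h1 (hAinj (by rw [h2, map_zero]))
  have hcoS : ∀ u, co S' u ≠ 0 → co S u ≠ 0 := by
    intro u h1 h2
    rw [coS] at h2
    exact h1 (hAinj (by rw [h2, map_zero]))
  have key : (n, m) = (0, 1) := by
    refine core (R := A) (k := k) hp ?_ hpk S' D' ?_ ?_ ?_ N ?_ ?_ (by omega) (by omega) n m ?_ ?_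
    · have : CharZero A := charZero_of_injective_algebraMap (R := ℤ) (by
        rw [algebraMap_int_eq]
        intro a b hab
        have := congrArg (algebraMap A K) hab
        simpa using this)
      exact_mod_cast hp.ne_zero
    · apply hinj
      rw [map_mul, hD', hS', hDS, map_add, map_mul, map_one, hD', hS']
    · apply hinj
      rw [← bet_map, hS', hbS]
    · apply hinj
      rw [← bet_map, map_smul, hD', hbD, algebra_compatible_smul K (-1 : A), map_neg, map_one]
    · exact Bd_of_co fun u hu => hS.co (hcoS u hu)
    · exact Bd_of_co fun u hu => hD.co (hco u hu)
    · exact hφ (co D' (n, m)).1 (co D' (n, m)).2 (by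
        have := mD _ hnm
        rw [coD] at this
        exact this)
    · intro u hu
      exact htop u (hco u hu)
  obtain ⟨rfl, rfl⟩ := Prod.mk.inj key
  refine ⟨co D (0, 1), ?_⟩
  have hrep : D = co D (0, 0) • 1 + co D (0, 1) • Wy K := by
    apply co_ext
    intro u
    have h0 := co_xy (R := K) 0 0 u
    have h1 := co_xy (R := K) 0 1 u
    rw [pow_zero, pow_zero, one_mul] at h0
    rw [pow_zero, pow_one, one_mul] at h1
    rw [co_add, co_smul, co_smul, h0, h1]
    by_cases hu : co D u = 0
    · rw [hu]
      by_cases e0 : u = (0, 0)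
      · subst e0; simp [hu]
      · by_cases e1 : u = (0, 1)
        · subst e1; simp [hu]
        · simp [e0, e1]
    · have := htop u hu
      obtain ⟨x, y⟩ := u
      simp only at this
      have hx : x = 0 := by omega
      have hy : y = 0 ∨ y = 1 := by omega
      subst hx
      rcases hy with rfl | rfl <;> simp
  have h2 := hbD
  rw [hrep, map_add, map_smul, map_smul, bet_one, bet_y] at h2
  have h3 := congrArg (fun a => co a (0, 0)) h2
  have h0 := co_xy (R := K) 0 0 (0, 0)
  have h1 := co_xy (R := K) 0 1 (0, 0)
  rw [pow_zero, pow_zero, one_mul] at h0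
  rw [pow_zero, pow_one, one_mul] at h1
  simp only [co_add, co_smul, co_neg, h0, h1] at h3
  have h4 : co D (0, 0) = 0 := by
    simp at h3
    exact self_eq_neg.1 h3
  rw [h4, zero_smul, zero_add] at hrep
  exact hrep

end
end WP

namespace WP
noncomputable section
open Polynomial

theorem ring_aux1 {K A : Type*} [Field K] [Ring A] [Algebra K A] (c : K) (hc : c ≠ 0) (x y q : A)
    (h : y * x = x * y + 1) (hq : y * q = q * y) :
    (c⁻¹ • y) * (c • x + q) = (c • x + q) * (c⁻¹ • y) + 1 := by
  simp only [mul_add, add_mul, smul_mul_assoc, mul_smul_comm, smul_add, smul_smul, h, hq,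
    inv_mul_cancel₀ hc, mul_inv_cancel₀ hc, one_smul]
  abel

theorem ring_aux2 {K A : Type*} [Field K] [Ring A] [Algebra K A] (c : K) (y s : A)
    (h : (c • y) * s = s * (c • y) + 1) : c • (y * s - s * y) = 1 := by
  rw [smul_mul_assoc, mul_smul_comm] at h
  rw [smul_sub, h]; abel

theorem bij_of_Y {K : Type} [Field K] [CharZero K] (F : Weyl K →ₐ[K] Weyl K) (c : K)
    (hY : F (Wy K) = c • Wy K) : Function.Bijective F := by
  have h1 : F (Wy K) * F (Wx K) = F (Wx K) * F (Wy K) + 1 := by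
    rw [← map_mul, rel, map_add, map_mul, map_one]
  rw [hY] at h1
  have h2 := ring_aux2 c (Wy K) (F (Wx K)) h1
  have hc : c ≠ 0 := by
    rintro rfl
    rw [zero_smul] at h2
    exact nontriv K h2.symm
  have h3 : ∀ u : ℕ × ℕ, c * ((u.1 + 1 : ℕ) * co (F (Wx K)) (u.1 + 1, u.2)) =
      if u = (0, 0) then 1 else 0 := by
    intro u
    have h0 := co_xy (R := K) 0 0 u
    rw [pow_zero, pow_zero, one_mul, ← h2, co_smul, rho_comm_y] at h0
    exact h0
  set P : K[X] := (cf (F (Wx K))).coeff 0 with hP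
  have hX : F (Wx K) = c⁻¹ • Wx K + aeval (Wy K) P := by
    apply co_ext
    rintro ⟨i, j⟩
    have hx := co_xy (R := K) 1 0 (i, j)
    rw [pow_zero, pow_one, mul_one] at hx
    rw [co_add, co_smul, hx, co, co, rho_alg]
    rcases i with _ | i
    · simp [hP]
    · have h4 := h3 (i, j)
      simp only [co] at h4
      have hi : ((i + 1 : ℕ) : K) ≠ 0 := by exact_mod_cast i.succ_ne_zero
      rw [coeff_C_succ, coeff_zero, add_zero]
      by_cases hij : i = 0 ∧ j = 0
      · obtain ⟨rfl, rfl⟩ := hij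
        simp at h4 ⊢
        exact eq_inv_of_mul_eq_one_right h4
      · have h5 : ¬ ((i, j) = (0, 0)) := by simpa using hij
        have h6 : ¬ ((i + 1, j) = (1, 0)) := by simpa using hij
        rw [if_neg h5] at h4
        rw [if_neg h6, mul_zero]
        exact ((mul_eq_zero.1 ((mul_eq_zero.1 h4).resolve_left hc)).resolve_left hi)
  let P' : K[X] := C (-c) * P.comp (C c⁻¹ * X)
  have hq : Wy K * aeval (Wy K) P' = aeval (Wy K) P' * Wy K := by
    have : aeval (Wy K) (X * P') = aeval (Wy K) (P' * X) := by rw [mul_comm]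
    rwa [map_mul _ X P', map_mul _ P' X, aeval_X] at this
  let G : Weyl K →ₐ[K] Weyl K := lift (c • Wx K + aeval (Wy K) P') (c⁻¹ • Wy K)
    (ring_aux1 c hc _ _ _ rel hq)
  have Gx : G (Wx K) = c • Wx K + aeval (Wy K) P' := lift_x _ _ _
  have Gy : G (Wy K) = c⁻¹ • Wy K := lift_y _ _ _
  have hP1 : ∀ y : Weyl K, aeval y P' = (-c) • aeval (c⁻¹ • y) P := by
    intro y
    simp only [P', map_mul, aeval_C, aeval_comp, aeval_X, ← Algebra.smul_def]
  have hFP : ∀ (H : Weyl K →ₐ[K] Weyl K) (Q : K[X]), H (aeval (Wy K) Q) = aeval (H (Wy K)) Q := by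
    intro H Q
    rw [aeval_algHom_apply]
  have hFG : F.comp G = AlgHom.id K _ := by
    apply hom_ext
    · rw [AlgHom.comp_apply, Gx, map_add, map_smul, hX, hFP, hY, hP1, smul_smul, inv_mul_cancel₀ hc,
        one_smul, AlgHom.id_apply, smul_add, smul_smul, mul_inv_cancel₀ hc, one_smul, add_assoc,
        ← add_smul, add_neg_cancel, zero_smul, add_zero]
    · rw [AlgHom.comp_apply, Gy, map_smul, hY, smul_smul, inv_mul_cancel₀ hc, one_smul,
        AlgHom.id_apply]
  have hGF : G.comp F = AlgHom.id K _ := by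
    apply hom_ext
    · rw [AlgHom.comp_apply, hX, map_add, map_smul, Gx, hFP, Gy, hP1, smul_add, smul_smul,
        inv_mul_cancel₀ hc, one_smul, smul_smul, mul_neg, inv_mul_cancel₀ hc, add_assoc,
        AlgHom.id_apply]
      nth_rewrite 2 [← one_smul K (aeval (c⁻¹ • Wy K) P)]
      rw [← add_smul, neg_add_cancel, zero_smul, add_zero]
    · rw [AlgHom.comp_apply, hY, map_smul, Gy, smul_smul, mul_inv_cancel₀ hc, one_smul,
        AlgHom.id_apply]
  refine ⟨Function.LeftInverse.injective (g := G) fun a => ?_,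
    Function.RightInverse.surjective (g := G) fun a => ?_⟩
  · exact DFunLike.congr_fun hGF a
  · exact DFunLike.congr_fun hFG a

def toHom {K A : Type} [CommRing K] [Ring A] [Algebra K A] (f : A → A) (hf : IsAlgEndo K f) :
    A →ₐ[K] A :=
  AlgHom.ofLinearMap { toFun := f, map_add' := hf.1, map_smul' := hf.2.1 } hf.2.2.2 hf.2.2.1

theorem toHom_apply {K A : Type} [CommRing K] [Ring A] [Algebra K A] (f : A → A)
    (hf : IsAlgEndo K f) (a : A) : toHom f hf a = f a := rfl

section
variable {K A : Type} [CommRing K] [Ring A] [Algebra K A] {f g : A → A}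

theorem ee (hf : IsAlgEndo K f) (hg : IsAlgEndo K g) : IsAlgEndo K (f ∘ g) :=
  ⟨fun a b => by simp only [Function.comp, hg.1, hf.1],
   fun a b => by simp only [Function.comp, hg.2.1, hf.2.1],
   fun a b => by simp only [Function.comp, hg.2.2.1, hf.2.2.1],
   by simp only [Function.comp, hg.2.2.2, hf.2.2.2]⟩

theorem aa (hf : IsAntiEndo K f) (hg : IsAntiEndo K g) : IsAlgEndo K (f ∘ g) :=
  ⟨fun a b => by simp only [Function.comp, hg.1, hf.1],
   fun a b => by simp only [Function.comp, hg.2.1, hf.2.1],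
   fun a b => by simp only [Function.comp, hg.2.2.1, hf.2.2.1],
   by simp only [Function.comp, hg.2.2.2, hf.2.2.2]⟩

theorem ae (hf : IsAntiEndo K f) (hg : IsAlgEndo K g) : IsAntiEndo K (f ∘ g) :=
  ⟨fun a b => by simp only [Function.comp, hg.1, hf.1],
   fun a b => by simp only [Function.comp, hg.2.1, hf.2.1],
   fun a b => by simp only [Function.comp, hg.2.2.1, hf.2.2.1],
   by simp only [Function.comp, hg.2.2.2, hf.2.2.2]⟩

theorem ea (hf : IsAlgEndo K f) (hg : IsAntiEndo K g) : IsAntiEndo K (f ∘ g) :=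
  ⟨fun a b => by simp only [Function.comp, hg.1, hf.1],
   fun a b => by simp only [Function.comp, hg.2.1, hf.2.1],
   fun a b => by simp only [Function.comp, hg.2.2.1, hf.2.2.1],
   by simp only [Function.comp, hg.2.2.2, hf.2.2.2]⟩

theorem inv_endo (hf : IsAlgAuto K f) : IsAlgEndo K (Function.invFun f) := by
  have hr : ∀ a, f (Function.invFun f a) = a := Function.rightInverse_invFun hf.2.2
  refine ⟨fun a b => hf.2.1 ?_, fun a b => hf.2.1 ?_, fun a b => hf.2.1 ?_, hf.2.1 ?_⟩
  · rw [hr, hf.1.1, hr, hr]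
  · rw [hr, hf.1.2.1, hr]
  · rw [hr, hf.1.2.2.1, hr, hr]
  · rw [hr, hf.1.2.2.2]
end

theorem anti_ext {K : Type} [CommRing K] {f g : Weyl K → Weyl K} (hf : IsAntiEndo K f)
    (hg : IsAntiEndo K g) (hx : f (Wx K) = g (Wx K)) (hy : f (Wy K) = g (Wy K)) (a : Weyl K) :
    f a = g a := by
  induction a using ind with
  | hc r => rw [Algebra.algebraMap_eq_smul_one, hf.2.1, hg.2.1, hf.2.2.2, hg.2.2.2]
  | hx => exact hx
  | hy => exact hy
  | ha a b h1 h2 => rw [hf.1, hg.1, h1, h2]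
  | hm a b h1 h2 => rw [hf.2.2.1, hg.2.2.1, h1, h2]

theorem bet_anti {K : Type} [CommRing K] : IsAntiEndo K (bet K) :=
  ⟨map_add _, map_smul _, bet_mul, bet_one⟩

theorem hom_endo {K : Type} [CommRing K] (F : Weyl K →ₐ[K] Weyl K) : IsAlgEndo K F :=
  ⟨map_add F, map_smul F, map_mul F, map_one F⟩

theorem aux_a {K A : Type*} [Field K] [CharZero K] [Ring A] [Algebra K A] {x y : A}
    (h : y * x = x * y + 1) :
    (x + (1/2 : K) • y) * (x + (-1/2 : K) • y) = (x + (-1/2 : K) • y) * (x + (1/2 : K) • y) + 1 := by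
  simp only [mul_add, add_mul, smul_mul_assoc, mul_smul_comm, h, smul_add]
  module

theorem aux_b {K A : Type*} [Field K] [CharZero K] [Ring A] [Algebra K A] {x y : A}
    (h : y * x = x * y + 1) :
    (y + (-1 : K) • x) * ((1/2 : K) • x + (1/2 : K) • y) =
      ((1/2 : K) • x + (1/2 : K) • y) * (y + (-1 : K) • x) + 1 := by
  simp only [mul_add, add_mul, smul_mul_assoc, mul_smul_comm, h, smul_add]
  module

theorem exists_psi (K : Type) [Field K] [CharZero K] : ∃ F : Weyl K →ₐ[K] Weyl K,
    Function.Bijective F ∧ F (Wx K) = Wx K + (-1/2 : K) • Wy K ∧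
      F (Wy K) = Wx K + (1/2 : K) • Wy K := by
  let F : Weyl K →ₐ[K] Weyl K := lift _ _ (aux_a (K := K) (rel (R := K)))
  let G : Weyl K →ₐ[K] Weyl K := lift _ _ (aux_b (K := K) (rel (R := K)))
  have Fx : F (Wx K) = Wx K + (-1/2 : K) • Wy K := lift_x _ _ _
  have Fy : F (Wy K) = Wx K + (1/2 : K) • Wy K := lift_y _ _ _
  have Gx : G (Wx K) = (1/2 : K) • Wx K + (1/2 : K) • Wy K := lift_x _ _ _
  have Gy : G (Wy K) = Wy K + (-1 : K) • Wx K := lift_y _ _ _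
  have hFG : F.comp G = AlgHom.id K _ := by
    apply hom_ext
    · rw [AlgHom.comp_apply, AlgHom.id_apply, Gx, map_add, map_smul, map_smul, Fx, Fy]
      module
    · rw [AlgHom.comp_apply, AlgHom.id_apply, Gy, map_add, map_smul, Fx, Fy]
      module
  have hGF : G.comp F = AlgHom.id K _ := by
    apply hom_ext
    · rw [AlgHom.comp_apply, AlgHom.id_apply, Fx, map_add, map_smul, Gx, Gy]
      module
    · rw [AlgHom.comp_apply, AlgHom.id_apply, Fy, map_add, map_smul, Gx, Gy]
      module
  refine ⟨F, ⟨Function.LeftInverse.injective (g := G) fun a => ?_,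
    Function.RightInverse.surjective (g := G) fun a => ?_⟩, Fx, Fy⟩
  · exact DFunLike.congr_fun hGF a
  · exact DFunLike.congr_fun hFG a

theorem neg_eq_smul {K : Type} [CommRing K] (a : Weyl K) : -a = (-1 : K) • a := by
  apply co_ext; intro u; rw [co_neg, co_smul]; ring

theorem conj_bet {K : Type} [Field K] [CharZero K] {α γ : Weyl K → Weyl K} (hα : IsExchange K α)
    (h : ConjToAlpha K α γ) : ∃ G : Weyl K → Weyl K, IsAlgAuto K G ∧
      ∀ a, G (γ a) = bet K (G a) := by
  obtain ⟨⟨⟨ha, hab⟩, hinv⟩, hax, hay⟩ := hα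
  obtain ⟨F, hF, Fx, Fy⟩ := exists_psi K
  have hFa : ∀ a, F (α a) = bet K (F a) := by
    apply anti_ext (ea (hom_endo F) ha) (ae bet_anti (hom_endo F))
    · simp only [Function.comp]
      rw [hax, Fx, Fy, map_add, map_smul, bet_x, bet_y, neg_eq_smul (Wy K), smul_smul]
      congr 2; ring
    · simp only [Function.comp]
      rw [hay, Fx, Fy, map_add, map_smul, bet_x, bet_y, neg_eq_smul (Wy K), smul_smul]
      congr 2; ring
  obtain ⟨g, hg, rfl⟩ := h
  have hgs : Function.Surjective g := by
    rcases hg with hg | hg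
    · exact hg.2.2
    · exact hg.2.2
  have hr : ∀ a, g ((Function.invFun g ∘ α ∘ g) a) = α (g a) := fun a =>
    Function.rightInverse_invFun hgs _
  rcases hg with hg | hg
  · refine ⟨F ∘ g, ⟨ee (hom_endo F) hg.1, hF.comp hg.2⟩, fun a => ?_⟩
    rw [Function.comp_apply, hr, hFa, Function.comp_apply]
  · refine ⟨F ∘ (α ∘ g), ⟨ee (hom_endo F) (aa ha hg.1), hF.comp (hab.comp hg.2)⟩, fun a => ?_⟩
    rw [Function.comp_apply, Function.comp_apply, hr, hFa, Function.comp_apply, Function.comp_apply]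

theorem final {K : Type} [Field K] [CharZero K] (α f : Weyl K → Weyl K)
    (hα : IsExchange K α) (hf : IsAlgEndo K f) (E E' : Weyl K → Weyl K)
    (hE : IsInvolutionOn K E) (hEα : ConjToAlpha K α E) (hE' : IsInvolutionOn K E')
    (hEα' : ConjToAlpha K α E') (hX : E' (f (Wx K)) = f (E (Wx K)))
    (hY : E' (f (Wy K)) = f (E (Wy K))) : IsAlgAuto K f := by
  refine ⟨hf, ?_⟩
  obtain ⟨G1, h1, hb1⟩ := conj_bet hα hEα
  obtain ⟨G2, h2, hb2⟩ := conj_bet hα hEα'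
  have hall : ∀ a, E' (f a) = f (E a) := anti_ext (ae hE'.1.1 hf) (ea hf hE.1.1) hX hY
  have hF : IsAlgEndo K (G2 ∘ (f ∘ Function.invFun G1)) := ee h2.1 (ee hf (inv_endo h1))
  let F := toHom _ hF
  have hFG : ∀ a, F (G1 a) = G2 (f a) := by
    intro a
    change G2 (f (Function.invFun G1 (G1 a))) = _
    rw [Function.leftInverse_invFun h1.2.1]
  have hFb : ∀ b, F (bet K b) = bet K (F b) := by
    intro b
    obtain ⟨a, rfl⟩ := h1.2.2 b
    rw [← hb1, hFG, hFG, ← hb2, hall]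
  obtain ⟨c, hc⟩ := symm_D (F (Wx K)) (F (Wy K))
    (by rw [← map_mul, rel, map_add, map_mul, map_one])
    (by rw [← hFb, bet_x]) (by rw [← hFb, bet_y, neg_eq_smul, map_smul])
  have hbij := bij_of_Y F c hc
  have h3 : G2 ∘ f = F ∘ G1 := funext fun a => (hFG a).symm
  rw [← Function.Bijective.of_comp_iff' h2.2 f, h3]
  exact hbij.comp h1.2

end
end WP

/-- generalized extension condition, first version: if there are involutions
`E` and `Ẽ` on `A₁`, each conjugate to `α`, with `Ẽ (f X) = f (E X)` and
`Ẽ (f Y) = f (E Y)` (equivalently `Ẽ ∘ f = f ∘ E`), then `f` is an automorphism. -/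
theorem stmt_8 {K : Type} [Field K] [CharZero K]
    (α f : Weyl K → Weyl K) (hα : IsExchange K α) (hf : IsAlgEndo K f)
    (E Etilde : Weyl K → Weyl K)
    (hE : IsInvolutionOn K E) (hEα : ConjToAlpha K α E)
    (hEt : IsInvolutionOn K Etilde) (hEtα : ConjToAlpha K α Etilde)
    (hX : Etilde (f (Wx K)) = f (E (Wx K)))
    (hY : Etilde (f (Wy K)) = f (E (Wy K))) :
    IsAlgAuto K f := 
  WP.final α f hα hf E Etilde hE hEα hEt hEtα hX hY
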